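/- arXiv:2006.05973 — 4 statements merged into one kernel-verified Lean document; each statement's English description precedes it below -/
import Mathlib

section
/- Assume φ'(∞) = +∞. Let ν be a probability measure on (Ω,F) and g : Ω → ℝ measurable. The following are equivalent: (i) there exists δ > 0 such that Λ_{g,ν}(t) < ∞ for every t with |t| < δ; (ii) there exists t > 0 with Λ_{|g|,ν}(t) < ∞; (iii) there exists c > 0 such that ∫ θ(c·g) dν < ∞, where θ(x) := max(ψ*(x), ψ*(−x)) (i.e., g belongs to the Orlicz space L^θ(ν)). -/
open MeasureTheory Filter Set
open scoped ENNReal NNReal Topology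

/-- Map an extended real to `ℝ≥0∞`, sending `⊤` to `⊤` and negative values to `0`. -/
noncomputable def erealToENNReal (x : EReal) : ℝ≥0∞ :=
  if x = ⊤ then ⊤ else ENNReal.ofReal x.toReal

/-- `ψ*(y) = sup_{x ∈ ℝ} (x·y − φ(x+1))`, the convex conjugate of `ψ(x) := φ(x+1)`.
Since `φ 1 = 0`, the supremum is nonnegative (take `x = 0`), so we record it in `ℝ≥0∞`. -/
noncomputable def psiStar (φ : ℝ → ℝ≥0∞) (y : ℝ) : ℝ≥0∞ :=
  erealToENNReal (⨆ x : ℝ, ((x * y : ℝ) : EReal) - ((φ (x + 1) : ℝ≥0∞) : EReal))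

/-- The `(φ,ν)`-cumulant generating function `Λ_{g,ν}(t) = inf_{λ ∈ ℝ} ∫ ψ*(t·g + λ) dν`. -/
noncomputable def cgf {Ω : Type*} [MeasurableSpace Ω] (φ : ℝ → ℝ≥0∞)
    (ν : Measure Ω) (g : Ω → ℝ) (t : ℝ) : ℝ≥0∞ :=
  ⨅ lam : ℝ, ∫⁻ ω, psiStar φ (t * g ω + lam) ∂ν

lemma psiStar_eq_iSup (φ : ℝ → ℝ≥0∞) (y : ℝ) :
    psiStar φ y = ⨆ x : ℝ, (ENNReal.ofReal (x * y) - φ (x + 1)) := by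
  have h0 : psiStar φ y =
      (⨆ x : ℝ, ((x * y : ℝ) : EReal) - ((φ (x + 1) : ℝ≥0∞) : EReal)).toENNReal := rfl
  rw [h0]
  apply le_antisymm
  · rw [← EReal.toENNReal_coe (x := ⨆ x : ℝ, (ENNReal.ofReal (x * y) - φ (x + 1)))]
    apply EReal.toENNReal_le_toENNReal
    apply iSup_le
    intro x
    apply EReal.sub_le_of_le_add
    have h1 : ENNReal.ofReal (x * y) ≤
        (⨆ x : ℝ, (ENNReal.ofReal (x * y) - φ (x + 1))) + φ (x + 1) :=
      tsub_le_iff_right.1 (le_iSup (fun x : ℝ => ENNReal.ofReal (x * y) - φ (x + 1)) x)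
    have h2 : ((x * y : ℝ) : EReal) ≤ ((ENNReal.ofReal (x * y) : ℝ≥0∞) : EReal) := by
      rw [EReal.coe_ennreal_ofReal]
      exact_mod_cast le_max_left _ _
    refine h2.trans ?_
    rw [← EReal.coe_ennreal_add]
    exact_mod_cast h1
  · apply iSup_le
    intro x
    refine le_trans ?_ (EReal.toENNReal_le_toENNReal
      (le_iSup (fun x : ℝ => ((x * y : ℝ) : EReal) - ((φ (x + 1) : ℝ≥0∞) : EReal)) x))
    rw [EReal.toENNReal_sub (by positivity), EReal.toENNReal_coe, EReal.toENNReal_of_ne_top (EReal.coe_ne_top _), EReal.toReal_coe]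

lemma psiStar_le_iff (φ : ℝ → ℝ≥0∞) (y : ℝ) (c : ℝ≥0∞) :
    psiStar φ y ≤ c ↔ ∀ x : ℝ, ENNReal.ofReal (x * y) ≤ c + φ (x + 1) := by
  rw [psiStar_eq_iSup, iSup_le_iff]
  simp only [tsub_le_iff_right]

lemma measurable_psiStar (φ : ℝ → ℝ≥0∞) : Measurable (psiStar φ) := by
  have : psiStar φ = fun y => ⨆ x : ℝ, (ENNReal.ofReal (x * y) - φ (x + 1)) :=
    funext (psiStar_eq_iSup φ)
  rw [this]
  apply LowerSemicontinuous.measurable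
  apply lowerSemicontinuous_iSup
  intro x
  apply Continuous.lowerSemicontinuous
  exact (ENNReal.continuous_sub_right _).comp
    (ENNReal.continuous_ofReal.comp (continuous_const.mul continuous_id))

lemma psiStar_convex (φ : ℝ → ℝ≥0∞) (y z : ℝ) (a b : ℝ≥0) (hab : a + b = 1) :
    psiStar φ (a * y + b * z) ≤ a * psiStar φ y + b * psiStar φ z := by
  rw [psiStar_le_iff]
  intro x
  have hy := (psiStar_le_iff φ y _).1 le_rfl x
  have hz := (psiStar_le_iff φ z _).1 le_rfl x
  have e : x * (a * y + b * z) = a * (x * y) + b * (x * z) := by ring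
  have hab' : (a : ℝ≥0∞) + b = 1 := by exact_mod_cast hab
  calc ENNReal.ofReal (x * (a * y + b * z))
      ≤ ENNReal.ofReal (a * (x * y)) + ENNReal.ofReal (b * (x * z)) := by
        rw [e]; exact ENNReal.ofReal_add_le
    _ = a * ENNReal.ofReal (x * y) + b * ENNReal.ofReal (x * z) := by
        rw [ENNReal.ofReal_mul a.coe_nonneg, ENNReal.ofReal_mul b.coe_nonneg]; simp
    _ ≤ a * (psiStar φ y + φ (x + 1)) + b * (psiStar φ z + φ (x + 1)) := by gcongr
    _ = a * psiStar φ y + b * psiStar φ z + (a + b) * φ (x + 1) := by ring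
    _ = _ := by rw [hab', one_mul]

lemma psiStar_zero (φ : ℝ → ℝ≥0∞) : psiStar φ 0 = 0 := by
  rw [← nonpos_iff_eq_zero, psiStar_le_iff]
  intro x
  simp

lemma psiStar_smul_le (φ : ℝ → ℝ≥0∞) (s y : ℝ) (h0 : 0 ≤ s) (h1 : s ≤ 1) :
    psiStar φ (s * y) ≤ psiStar φ y := by
  lift s to ℝ≥0 using h0
  have h1' : s ≤ 1 := by exact_mod_cast h1
  have h := psiStar_convex φ y 0 s (1 - s) (add_tsub_cancel_of_le h1')
  simp only [mul_zero, add_zero, psiStar_zero] at h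
  refine h.trans ?_
  calc (s : ℝ≥0∞) * psiStar φ y ≤ 1 * psiStar φ y := by
        gcongr
        exact_mod_cast h1'
    _ = _ := one_mul _

lemma psiStar_ne_top (φ : ℝ → ℝ≥0∞) (hneg : ∀ x : ℝ, x < 0 → φ x = ⊤)
    (hdphi : Tendsto (fun x : ℝ => φ x / ENNReal.ofReal x) atTop (𝓝 ⊤)) (y : ℝ) :
    psiStar φ y ≠ ⊤ := by
  have h1 : ∀ᶠ x : ℝ in atTop, ENNReal.ofReal |y| < φ x / ENNReal.ofReal x :=
    hdphi.eventually (lt_mem_nhds ENNReal.ofReal_lt_top)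
  obtain ⟨M, hM⟩ := eventually_atTop.1 h1
  refine ne_top_of_le_ne_top (b := ENNReal.ofReal ((|M| + 2) * |y|)) ENNReal.ofReal_ne_top ?_
  rw [psiStar_le_iff]
  intro x
  by_cases hx : x + 1 < 0
  · simp [hneg _ hx]
  push Not at hx
  by_cases hx2 : x + 1 ≤ |M| + 1
  · refine le_trans (ENNReal.ofReal_le_ofReal ?_) le_self_add
    calc x * y ≤ |x * y| := le_abs_self _
      _ = |x| * |y| := abs_mul _ _
      _ ≤ _ := by
        gcongr
        rw [abs_le]
        constructor <;> linarith [abs_nonneg M]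
  · push Not at hx2
    have h2 := hM (x + 1) (by linarith [le_abs_self M])
    have hpos : 0 < x + 1 := by linarith [abs_nonneg M]
    have h3 : ENNReal.ofReal |y| * ENNReal.ofReal (x + 1) ≤ φ (x + 1) :=
      (ENNReal.le_div_iff_mul_le (Or.inl (by simpa using hpos))
        (Or.inl ENNReal.ofReal_ne_top)).1 h2.le
    refine le_trans ?_ (h3.trans le_add_self)
    rw [← ENNReal.ofReal_mul (abs_nonneg y)]
    apply ENNReal.ofReal_le_ofReal
    nlinarith [le_abs_self y, abs_nonneg y, abs_nonneg M]

/-- Removing the shift `lam` at the cost of halving `t`. -/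
lemma lintegral_half_ne_top {Ω : Type*} [MeasurableSpace Ω] (φ : ℝ → ℝ≥0∞)
    (hfin : ∀ y, psiStar φ y ≠ ⊤) (ν : Measure Ω) [IsProbabilityMeasure ν] (g : Ω → ℝ)
    (t : ℝ) (h : cgf φ ν g t ≠ ⊤) :
    ∫⁻ ω, psiStar φ (t / 2 * g ω) ∂ν ≠ ⊤ := by
  have h' : ∃ lam : ℝ, ∫⁻ ω, psiStar φ (t * g ω + lam) ∂ν ≠ ⊤ := by
    by_contra hc
    push Not at hc
    exact h (by simp [cgf, hc])
  obtain ⟨lam, hl⟩ := h'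
  refine ne_top_of_le_ne_top
    (b := ∫⁻ ω, (psiStar φ (t * g ω + lam) + psiStar φ (-lam)) ∂ν) ?_ ?_
  · rw [lintegral_add_right _ measurable_const]
    simp [hl, hfin]
  · apply lintegral_mono
    intro ω
    have e : t / 2 * g ω = ((1 / 2 : ℝ≥0) : ℝ) * (t * g ω + lam) +
        ((1 / 2 : ℝ≥0) : ℝ) * (-lam) := by push_cast; ring
    have hle : (((1 / 2 : ℝ≥0)) : ℝ≥0∞) ≤ 1 := by
      have : (1 / 2 : ℝ≥0) ≤ 1 := half_le_self zero_le_one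
      exact_mod_cast this
    simp only [e]
    refine (psiStar_convex φ _ _ _ _ (add_halves 1)).trans ?_
    calc _ ≤ 1 * psiStar φ (t * g ω + lam) + 1 * psiStar φ (-lam) := by gcongr
      _ = _ := by simp

lemma psiStar_neg_le (φ : ℝ → ℝ≥0∞) (hneg : ∀ x : ℝ, x < 0 → φ x = ⊤)
    (hdom : (1 : ℝ) ∈ interior {x : ℝ | φ x ≠ ⊤}) :
    ∃ A K : ℝ≥0∞, A ≠ ⊤ ∧ K ≠ ⊤ ∧
      ∀ y : ℝ, 0 ≤ y → psiStar φ (-y) ≤ A * psiStar φ y + K := by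
  obtain ⟨r, hr, hsub⟩ := Metric.mem_nhds_iff.1 (mem_interior_iff_mem_nhds.1 hdom)
  set ε : ℝ := r / 2 with hε
  have hεpos : 0 < ε := by positivity
  have hfin : φ (ε + 1) ≠ ⊤ := hsub (by
    simp [Real.dist_eq, abs_of_pos hεpos]; linarith)
  refine ⟨ENNReal.ofReal ε⁻¹, ENNReal.ofReal ε⁻¹ * φ (ε + 1), ENNReal.ofReal_ne_top,
    ENNReal.mul_ne_top ENNReal.ofReal_ne_top hfin, ?_⟩
  intro y hy
  have h1 : psiStar φ (-y) ≤ ENNReal.ofReal y := by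
    rw [psiStar_le_iff]
    intro x
    by_cases hx : x + 1 < 0
    · simp [hneg _ hx]
    refine le_trans (ENNReal.ofReal_le_ofReal ?_) le_self_add
    nlinarith
  have h2 := (psiStar_le_iff φ y _).1 le_rfl ε
  calc psiStar φ (-y) ≤ ENNReal.ofReal y := h1
    _ = ENNReal.ofReal ε⁻¹ * ENNReal.ofReal (ε * y) := by
      rw [← ENNReal.ofReal_mul (by positivity)]
      congr 1
      field_simp
    _ ≤ ENNReal.ofReal ε⁻¹ * (psiStar φ y + φ (ε + 1)) := by gcongr
    _ = _ := by ring

/-- **Characterizations of `(φ,ν)`-subexponential functions when `φ'(∞) = ∞`.**  The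
following are equivalent: (i) `Λ_{g,ν}` is finite on a neighborhood of `0`;
(ii) `Λ_{|g|,ν}(t) < ∞` for some `t > 0`; (iii) `∫ θ(c·g) dν < ∞` for some `c > 0`, where
`θ(x) = max(ψ*(x), ψ*(−x))` (i.e. `g` belongs to the Orlicz space `L^θ(ν)`). -/
theorem subexponential_tfae {Ω : Type*} [MeasurableSpace Ω] (φ : ℝ → ℝ≥0∞)
    (hconv : ∀ x y : ℝ, ∀ a b : ℝ≥0, a + b = 1 →
      φ ((a : ℝ) * x + (b : ℝ) * y) ≤ (a : ℝ≥0∞) * φ x + (b : ℝ≥0∞) * φ y)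
    (hlsc : LowerSemicontinuous φ)
    (hneg : ∀ x : ℝ, x < 0 → φ x = ⊤)
    (hone : φ 1 = 0)
    (hdom : (1 : ℝ) ∈ interior {x : ℝ | φ x ≠ ⊤})
    (hdphi : Tendsto (fun x : ℝ => φ x / ENNReal.ofReal x) atTop (𝓝 ⊤))
    (ν : Measure Ω) [IsProbabilityMeasure ν]
    (g : Ω → ℝ) (hg : Measurable g) :
    ((∃ δ : ℝ, 0 < δ ∧ ∀ t : ℝ, |t| < δ → cgf φ ν g t ≠ ⊤)
      ↔ (∃ t : ℝ, 0 < t ∧ cgf φ ν (fun ω => |g ω|) t ≠ ⊤))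
    ∧ ((∃ t : ℝ, 0 < t ∧ cgf φ ν (fun ω => |g ω|) t ≠ ⊤)
      ↔ (∃ c : ℝ, 0 < c ∧
          ∫⁻ ω, max (psiStar φ (c * g ω)) (psiStar φ (-(c * g ω))) ∂ν ≠ ⊤)) := by
  have hfin := psiStar_ne_top φ hneg hdphi
  have hm := measurable_psiStar φ
  have h13 : (∃ δ : ℝ, 0 < δ ∧ ∀ t : ℝ, |t| < δ → cgf φ ν g t ≠ ⊤) →
      (∃ c : ℝ, 0 < c ∧
          ∫⁻ ω, max (psiStar φ (c * g ω)) (psiStar φ (-(c * g ω))) ∂ν ≠ ⊤) := by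
    rintro ⟨δ, hδ, h⟩
    refine ⟨δ / 2 / 2, by positivity, ?_⟩
    have a1 := lintegral_half_ne_top φ hfin ν g (δ / 2)
      (h _ (by rw [abs_of_pos (by positivity)]; linarith))
    have a2 := lintegral_half_ne_top φ hfin ν g (-(δ / 2))
      (h _ (by rw [abs_neg, abs_of_pos (by positivity)]; linarith))
    refine ne_top_of_le_ne_top (ENNReal.add_ne_top.2 ⟨a1, a2⟩) ?_
    rw [← lintegral_add_left (by fun_prop)]
    apply lintegral_mono
    intro ω
    have e : -(δ / 2 / 2 * g ω) = -(δ / 2) / 2 * g ω := by ring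
    simp only [e]
    exact max_le le_self_add le_add_self
  have h31 : (∃ c : ℝ, 0 < c ∧
          ∫⁻ ω, max (psiStar φ (c * g ω)) (psiStar φ (-(c * g ω))) ∂ν ≠ ⊤) →
      (∃ δ : ℝ, 0 < δ ∧ ∀ t : ℝ, |t| < δ → cgf φ ν g t ≠ ⊤) := by
    rintro ⟨c, hc, h⟩
    refine ⟨c, hc, fun t ht => ?_⟩
    refine ne_top_of_le_ne_top h ((iInf_le _ 0).trans (lintegral_mono fun ω => ?_))
    rw [add_zero]
    have hs : |t| / c ≤ 1 := (div_le_one hc).2 ht.le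
    rcases le_total 0 t with h0 | h0
    · refine le_trans ?_ (le_max_left _ _)
      have e : t * g ω = |t| / c * (c * g ω) := by rw [abs_of_nonneg h0]; field_simp
      rw [e]
      exact psiStar_smul_le φ _ _ (by positivity) hs
    · refine le_trans ?_ (le_max_right _ _)
      have e : t * g ω = |t| / c * (-(c * g ω)) := by rw [abs_of_nonpos h0]; field_simp
      rw [e]
      exact psiStar_smul_le φ _ _ (by positivity) hs
  have h32 : (∃ c : ℝ, 0 < c ∧
          ∫⁻ ω, max (psiStar φ (c * g ω)) (psiStar φ (-(c * g ω))) ∂ν ≠ ⊤) →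
      (∃ t : ℝ, 0 < t ∧ cgf φ ν (fun ω => |g ω|) t ≠ ⊤) := by
    rintro ⟨c, hc, h⟩
    refine ⟨c, hc, ?_⟩
    refine ne_top_of_le_ne_top h ((iInf_le _ 0).trans (lintegral_mono fun ω => ?_))
    rw [add_zero]
    rcases abs_choice (g ω) with e | e
    · simp only [e]; exact le_max_left _ _
    · simp only [e, mul_neg]; exact le_max_right _ _
  have h23 : (∃ t : ℝ, 0 < t ∧ cgf φ ν (fun ω => |g ω|) t ≠ ⊤) →
      (∃ c : ℝ, 0 < c ∧
          ∫⁻ ω, max (psiStar φ (c * g ω)) (psiStar φ (-(c * g ω))) ∂ν ≠ ⊤) := by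
    rintro ⟨t, ht, h⟩
    refine ⟨t / 2, by positivity, ?_⟩
    have a1 := lintegral_half_ne_top φ hfin ν _ t h
    obtain ⟨A, K, hA, hK, hAK⟩ := psiStar_neg_le φ hneg hdom
    have hb : ∫⁻ ω, (psiStar φ (t / 2 * |g ω|) + (A * psiStar φ (t / 2 * |g ω|) + K)) ∂ν ≠ ⊤ := by
      rw [lintegral_add_left (by fun_prop), lintegral_add_right _ measurable_const,
        lintegral_const_mul' _ _ hA]
      simp only [lintegral_const, measure_univ, mul_one]
      exact ENNReal.add_ne_top.2 ⟨a1, ENNReal.add_ne_top.2 ⟨ENNReal.mul_ne_top hA a1, hK⟩⟩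
    refine ne_top_of_le_ne_top hb (lintegral_mono fun ω => ?_)
    have key := hAK (t / 2 * |g ω|) (by positivity)
    have key2 : max (psiStar φ (t / 2 * |g ω|)) (psiStar φ (-(t / 2 * |g ω|))) ≤
        psiStar φ (t / 2 * |g ω|) + (A * psiStar φ (t / 2 * |g ω|) + K) :=
      max_le le_self_add (key.trans le_add_self)
    refine le_trans (le_of_eq ?_) key2
    rcases abs_choice (g ω) with e | e
    · rw [e]
    · rw [e, mul_neg, neg_neg, max_comm]
  exact ⟨⟨fun h => h32 (h13 h), fun h => h31 (h23 h)⟩, ⟨h23, h32⟩⟩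
end

section
/- Let ν be a probability measure on (Ω,F) and g : Ω → ℝ measurable. The following are equivalent: (i) there exists δ > 0 such that Λ_{g,ν}(t) < ∞ for every t with |t| < δ (g is (φ,ν)-subexponential); (ii) g ∈ L¹(μ) for every finite nonnegative measure μ ≪ ν with D_φ(μ‖ν) < ∞; (iii) g ∈ L¹(μ) for every probability measure μ ≪ ν with D_φ(μ‖ν) < ∞. -/
open MeasureTheory Filter Set
open scoped ENNReal NNReal Topology

/-- The φ-divergence `D_φ(μ‖ν) = ∫ φ(dμ/dν) dν` for `μ ≪ ν`. -/
noncomputable def divAC {Ω : Type*} [MeasurableSpace Ω] (φ : ℝ → ℝ≥0∞)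
    (μ ν : Measure Ω) : ℝ≥0∞ :=
  ∫⁻ ω, φ ((μ.rnDeriv ν ω).toReal) ∂ν

lemma erealToENNReal_eq (x : EReal) : erealToENNReal x = x.toENNReal := rfl

lemma psiStar_ge (φ : ℝ → ℝ≥0∞) (x y : ℝ) (hx : φ (x + 1) ≠ ⊤) :
    ENNReal.ofReal (x * y - (φ (x + 1)).toReal) ≤ psiStar φ y := by
  unfold psiStar
  rw [erealToENNReal_eq]
  have h : ((x * y - (φ (x + 1)).toReal : ℝ) : EReal) ≤
      ⨆ x : ℝ, ((x * y : ℝ) : EReal) - ((φ (x + 1) : ℝ≥0∞) : EReal) := by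
    refine le_iSup_of_le x ?_
    rw [EReal.coe_sub, EReal.coe_ennreal_toReal hx]
  have := EReal.toENNReal_le_toENNReal h
  rwa [EReal.toENNReal_of_ne_top (EReal.coe_ne_top _), EReal.toReal_coe] at this

lemma psiStar_le (φ : ℝ → ℝ≥0∞) (y : ℝ) (c : ℝ≥0∞)
    (h : ∀ x : ℝ, φ (x + 1) ≠ ⊤ → ENNReal.ofReal (x * y - (φ (x + 1)).toReal) ≤ c) :
    psiStar φ y ≤ c := by
  unfold psiStar
  rw [erealToENNReal_eq]
  have h : (⨆ x : ℝ, ((x * y : ℝ) : EReal) - ((φ (x + 1) : ℝ≥0∞) : EReal)) ≤ (c : EReal) := by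
    refine iSup_le fun x => ?_
    by_cases hx : φ (x + 1) = ⊤
    · rw [hx]; simp
    · rw [← EReal.coe_ennreal_toReal hx, ← EReal.coe_sub]
      refine le_trans ?_ (EReal.coe_ennreal_le_coe_ennreal_iff.2 (h x hx))
      rw [EReal.coe_ennreal_ofReal]
      exact EReal.coe_le_coe_iff.2 (le_max_left _ _)
  have := EReal.toENNReal_le_toENNReal h
  simpa using this

lemma phi_scale (φ : ℝ → ℝ≥0∞)
    (hconv : ∀ x y : ℝ, ∀ a b : ℝ≥0, a + b = 1 →
      φ ((a : ℝ) * x + (b : ℝ) * y) ≤ (a : ℝ≥0∞) * φ x + (b : ℝ≥0∞) * φ y)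
    (hone : φ 1 = 0) (s x : ℝ) (h0 : 0 ≤ s) (h1 : s ≤ 1) :
    φ (s * x + (1 - s)) ≤ ENNReal.ofReal s * φ x := by
  have := hconv x 1 s.toNNReal (1 - s).toNNReal (by
    rw [← Real.toNNReal_add h0 (by linarith)]; simp)
  rw [hone, mul_zero, add_zero, Real.coe_toNNReal _ h0, Real.coe_toNNReal _ (by linarith),
    mul_one] at this
  exact this

lemma psiStar_rat (φ : ℝ → ℝ≥0∞)
    (hconv : ∀ x y : ℝ, ∀ a b : ℝ≥0, a + b = 1 →
      φ ((a : ℝ) * x + (b : ℝ) * y) ≤ (a : ℝ≥0∞) * φ x + (b : ℝ≥0∞) * φ y)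
    (hone : φ 1 = 0) (y : ℝ) :
    psiStar φ y = ⨆ q : {q : ℚ // φ ((q : ℝ) + 1) ≠ ⊤},
      ENNReal.ofReal ((q.1 : ℝ) * y - (φ ((q.1 : ℝ) + 1)).toReal) := by
  refine le_antisymm (psiStar_le _ _ _ fun x hx => ?_) (iSup_le fun q => psiStar_ge _ _ _ q.2)
  by_contra hlt
  push Not at hlt
  set S := ⨆ q : {q : ℚ // φ ((q : ℝ) + 1) ≠ ⊤},
      ENNReal.ofReal ((q.1 : ℝ) * y - (φ ((q.1 : ℝ) + 1)).toReal) with hS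
  have hSt : S ≠ ⊤ := ne_top_of_lt hlt
  set v := x * y - (φ (x + 1)).toReal with hv
  have hcv : S.toReal < v := (ENNReal.lt_ofReal_iff_toReal_lt hSt).1 hlt
  have hc0 : 0 ≤ S.toReal := ENNReal.toReal_nonneg
  have hv0 : 0 < v := lt_of_le_of_lt hc0 hcv
  have hx0 : x ≠ 0 := by
    rintro rfl
    have : 0 ≤ (φ (0 + 1)).toReal := ENNReal.toReal_nonneg
    simp only [hv, zero_mul] at hv0
    linarith
  -- find s
  obtain ⟨s, hs, hs1⟩ : ∃ s : ℝ, S.toReal / v < s ∧ s < 1 :=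
    exists_between ((div_lt_one hv0).2 hcv)
  have hs0 : 0 < s := lt_of_le_of_lt (by positivity) hs
  have hsv : S.toReal < s * v := (div_lt_iff₀ hv0).1 hs
  obtain ⟨q, r, hr1, hr2, hq⟩ : ∃ q : ℚ, ∃ r : ℝ, s < r ∧ r < 1 ∧ (q : ℝ) = r * x := by
    rcases lt_or_gt_of_ne hx0 with h | h
    · obtain ⟨q, h1, h2⟩ := exists_rat_btwn (show x < s * x by nlinarith)
      refine ⟨q, q / x, ?_, ?_, by field_simp⟩
      · rw [lt_div_iff_of_neg h]; exact h2
      · rw [div_lt_iff_of_neg h]; linarith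
    · obtain ⟨q, h1, h2⟩ := exists_rat_btwn (show s * x < x by nlinarith)
      refine ⟨q, q / x, ?_, ?_, by field_simp⟩
      · rw [lt_div_iff₀ h]; exact h1
      · rw [div_lt_iff₀ h]; linarith
  have hr0 : 0 < r := hs0.trans hr1
  have hsc := phi_scale φ hconv hone r (x + 1) hr0.le hr2.le
  have he : r * (x + 1) + (1 - r) = (q : ℝ) + 1 := by rw [hq]; ring
  rw [he] at hsc
  have hfin : ENNReal.ofReal r * φ (x + 1) ≠ ⊤ := ENNReal.mul_ne_top ENNReal.ofReal_ne_top hx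
  have hqt : φ ((q : ℝ) + 1) ≠ ⊤ := ne_top_of_le_ne_top hfin hsc
  have h1 := ENNReal.toReal_mono hfin hsc
  rw [ENNReal.toReal_mul, ENNReal.toReal_ofReal hr0.le] at h1
  have h2 : ENNReal.ofReal ((q : ℝ) * y - (φ ((q : ℝ) + 1)).toReal) ≤ S :=
    le_iSup (fun q : {q : ℚ // φ ((q : ℝ) + 1) ≠ ⊤} =>
      ENNReal.ofReal ((q.1 : ℝ) * y - (φ ((q.1 : ℝ) + 1)).toReal)) ⟨q, hqt⟩
  rw [ENNReal.ofReal_le_iff_le_toReal hSt] at h2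
  have h3 : r * v ≤ (q : ℝ) * y - (φ ((q : ℝ) + 1)).toReal := by
    rw [hq] at h1 ⊢; rw [hv]; nlinarith
  nlinarith

lemma psiStar_meas (φ : ℝ → ℝ≥0∞)
    (hconv : ∀ x y : ℝ, ∀ a b : ℝ≥0, a + b = 1 →
      φ ((a : ℝ) * x + (b : ℝ) * y) ≤ (a : ℝ≥0∞) * φ x + (b : ℝ≥0∞) * φ y)
    (hone : φ 1 = 0) : Measurable (psiStar φ) := by
  have : psiStar φ = fun y => ⨆ q : {q : ℚ // φ ((q : ℝ) + 1) ≠ ⊤},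
      ENNReal.ofReal ((q.1 : ℝ) * y - (φ ((q.1 : ℝ) + 1)).toReal) :=
    funext fun y => psiStar_rat φ hconv hone y
  rw [this]
  exact Measurable.iSup fun q => by fun_prop

lemma psiStar_mono_of_nonneg (φ : ℝ → ℝ≥0∞) (y z : ℝ) (hy : 0 ≤ y) (hyz : y ≤ z) :
    psiStar φ y ≤ psiStar φ z := by
  refine psiStar_le _ _ _ fun x hx => ?_
  have h0 : 0 ≤ (φ (x + 1)).toReal := ENNReal.toReal_nonneg
  rcases le_total 0 x with h | h
  · exact le_trans (ENNReal.ofReal_le_ofReal (by nlinarith)) (psiStar_ge φ x z hx)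
  · rw [ENNReal.ofReal_of_nonpos (by nlinarith)]; exact zero_le

lemma psiStar_nonpos (φ : ℝ → ℝ≥0∞) (hneg : ∀ x : ℝ, x < 0 → φ x = ⊤)
    (y : ℝ) (hy : y ≤ 0) :
    psiStar φ y ≤ ENNReal.ofReal |y| := by
  refine psiStar_le _ _ _ fun x hx => ?_
  have h0 : 0 ≤ (φ (x + 1)).toReal := ENNReal.toReal_nonneg
  have : 0 ≤ x + 1 := by
    by_contra h; exact hx (hneg _ (by linarith))
  apply ENNReal.ofReal_le_ofReal
  rw [abs_of_nonpos hy]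
  nlinarith

lemma psi_integrable {Ω : Type*} [MeasurableSpace Ω] (φ : ℝ → ℝ≥0∞)
    (hdom : (1 : ℝ) ∈ interior {x : ℝ | φ x ≠ ⊤})
    (ν : Measure Ω) [IsProbabilityMeasure ν]
    (h : Ω → ℝ) (hh : Measurable h) (hp : ∫⁻ ω, psiStar φ (h ω) ∂ν ≠ ⊤) :
    Integrable h ν := by
  obtain ⟨ε, hε, hball⟩ := Metric.mem_nhds_iff.1 (mem_interior_iff_mem_nhds.1 hdom)
  have h1 : φ (ε / 2 + 1) ≠ ⊤ := hball (by simp [abs_of_pos hε]; linarith)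
  have h2 : φ (-(ε / 2) + 1) ≠ ⊤ := hball (by simp [abs_of_pos hε]; linarith)
  have key : ∀ y, ENNReal.ofReal (ε / 2) * ENNReal.ofReal |y| ≤
      psiStar φ y + (φ (ε / 2 + 1) + φ (-(ε / 2) + 1)) := by
    intro y
    rw [← ENNReal.ofReal_mul (by positivity)]
    have aux : ∀ x : ℝ, φ (x + 1) ≠ ⊤ → ENNReal.ofReal (x * y) ≤ psiStar φ y + φ (x + 1) := by
      intro x hx
      have := psiStar_ge φ x y hx
      calc ENNReal.ofReal (x * y) = ENNReal.ofReal
            ((x * y - (φ (x + 1)).toReal) + (φ (x + 1)).toReal) := by congr 1; ring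
        _ ≤ _ := ENNReal.ofReal_add_le
        _ ≤ _ := by
          gcongr
          rw [ENNReal.ofReal_toReal hx]
    rcases le_total 0 y with hy | hy
    · rw [abs_of_nonneg hy]
      exact (aux _ h1).trans (by gcongr; exact le_self_add)
    · rw [abs_of_nonpos hy, mul_neg, ← neg_mul]
      exact (aux _ h2).trans (by gcongr; exact le_add_self)
  refine ⟨hh.aestronglyMeasurable, ?_⟩
  rw [hasFiniteIntegral_iff_norm]
  have hlt : ENNReal.ofReal (ε / 2) * ∫⁻ ω, ENNReal.ofReal ‖h ω‖ ∂ν < ⊤ := by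
    rw [← lintegral_const_mul _ (by fun_prop)]
    refine lt_of_le_of_lt (lintegral_mono fun ω => key (h ω)) ?_
    rw [lintegral_add_right _ measurable_const, lintegral_const]
    simp only [measure_univ, mul_one]
    exact ENNReal.add_lt_top.2 ⟨hp.lt_top, ENNReal.add_lt_top.2 ⟨h1.lt_top, h2.lt_top⟩⟩
  by_contra hcon
  rw [not_lt, top_le_iff] at hcon
  rw [hcon, ENNReal.mul_top (by simpa using hε)] at hlt
  exact lt_irrefl _ hlt

/-- Fenchel-Young half of (i) → (ii). -/
lemma half_finite {Ω : Type*} [MeasurableSpace Ω] (φ : ℝ → ℝ≥0∞)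
    (hlsc : LowerSemicontinuous φ)
    (hdom : (1 : ℝ) ∈ interior {x : ℝ | φ x ≠ ⊤})
    (ν : Measure Ω) [IsProbabilityMeasure ν] (f : Ω → ℝ) (hf : Measurable f)
    (hD : ∫⁻ ω, φ (f ω) ∂ν ≠ ⊤)
    (h : Ω → ℝ) (hh : Measurable h) (hp : ∫⁻ ω, psiStar φ (h ω) ∂ν ≠ ⊤) :
    ∫⁻ ω, ENNReal.ofReal (f ω * h ω) ∂ν ≠ ⊤ := by
  have hi := psi_integrable φ hdom ν h hh hp
  have key : ∀ ω, ENNReal.ofReal (f ω * h ω) ≤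
      φ (f ω) + (ENNReal.ofReal ‖h ω‖ + psiStar φ (h ω)) := by
    intro ω
    by_cases hx : φ (f ω) = ⊤
    · simp [hx]
    have h1 := psiStar_ge φ (f ω - 1) (h ω) (by simpa using hx)
    rw [sub_add_cancel] at h1
    calc ENNReal.ofReal (f ω * h ω) ≤ ENNReal.ofReal
          ((φ (f ω)).toReal + (‖h ω‖ + ((f ω - 1) * h ω - (φ (f ω)).toReal))) := by
            apply ENNReal.ofReal_le_ofReal
            have := le_abs_self (h ω)
            rw [Real.norm_eq_abs]; linarith
      _ ≤ _ := ENNReal.ofReal_add_le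
      _ ≤ _ := by
        gcongr
        · rw [ENNReal.ofReal_toReal hx]
        · exact ENNReal.ofReal_add_le.trans (by gcongr)
  refine ne_top_of_le_ne_top ?_ (lintegral_mono key)
  rw [lintegral_add_left (f := fun ω => φ (f ω)) (hlsc.measurable.comp hf), lintegral_add_left (by fun_prop)]
  have := (hasFiniteIntegral_iff_norm h).1 hi.2
  exact (ENNReal.add_lt_top.2 ⟨hD.lt_top, ENNReal.add_lt_top.2 ⟨this, hp.lt_top⟩⟩).ne

lemma i_imp_ii {Ω : Type*} [MeasurableSpace Ω] (φ : ℝ → ℝ≥0∞)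
    (hlsc : LowerSemicontinuous φ)
    (hdom : (1 : ℝ) ∈ interior {x : ℝ | φ x ≠ ⊤})
    (ν : Measure Ω) [IsProbabilityMeasure ν]
    (g : Ω → ℝ) (hg : Measurable g)
    (hi : ∃ δ : ℝ, 0 < δ ∧ ∀ t : ℝ, |t| < δ → cgf φ ν g t ≠ ⊤)
    (μ : Measure Ω) [IsFiniteMeasure μ] (hμ : μ ≪ ν) (hD : divAC φ μ ν ≠ ⊤) :
    Integrable g μ := by
  obtain ⟨δ, hδ, hi⟩ := hi
  have ht : 0 < δ / 2 := by positivity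
  set t := δ / 2 with htd
  have h1 := hi t (by rw [abs_of_pos ht]; linarith)
  have h2 := hi (-t) (by rw [abs_neg, abs_of_pos ht]; linarith)
  obtain ⟨a, ha⟩ := iInf_lt_top.1 h1.lt_top
  obtain ⟨b, hb⟩ := iInf_lt_top.1 h2.lt_top
  set f : Ω → ℝ := fun ω => (μ.rnDeriv ν ω).toReal with hfdef
  have hf : Measurable f := (Measure.measurable_rnDeriv μ ν).ennreal_toReal
  have hfi : Integrable f ν := Measure.integrable_toReal_rnDeriv
  have hA := half_finite φ hlsc hdom ν f hf hD _ (by fun_prop) ha.ne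
  have hB := half_finite φ hlsc hdom ν f hf hD _ (by fun_prop) hb.ne
  rw [← integrable_rnDeriv_smul_iff hμ]
  have hC : ∫⁻ ω, ENNReal.ofReal (f ω * (|a| + |b|)) ∂ν ≠ ⊤ :=
    (hfi.mul_const _).lintegral_lt_top.ne
  have hT : ∫⁻ ω, ENNReal.ofReal ‖t * (f ω * g ω)‖ ∂ν < ⊤ := by
    have key : ∀ ω, ENNReal.ofReal ‖t * (f ω * g ω)‖ ≤ ENNReal.ofReal (f ω * (t * g ω + a)) +
      (ENNReal.ofReal (f ω * (-t * g ω + b)) + ENNReal.ofReal (f ω * (|a| + |b|))) := by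
      intro ω
      have hf0 : 0 ≤ f ω := ENNReal.toReal_nonneg
      have ha' := neg_abs_le a
      have hb' := neg_abs_le b
      have ha0 := abs_nonneg a
      have hb0 := abs_nonneg b
      rw [Real.norm_eq_abs, abs_mul, abs_mul, abs_of_pos ht, abs_of_nonneg hf0]
      rcases le_total 0 (g ω) with h | h
      · rw [abs_of_nonneg h]
        calc _ ≤ ENNReal.ofReal (f ω * (t * g ω + a) + f ω * (|a| + |b|)) := by
              apply ENNReal.ofReal_le_ofReal; nlinarith
          _ ≤ _ := ENNReal.ofReal_add_le
          _ ≤ _ := by gcongr; exact le_add_self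
      · rw [abs_of_nonpos h]
        calc _ ≤ ENNReal.ofReal (f ω * (-t * g ω + b) + f ω * (|a| + |b|)) := by
              apply ENNReal.ofReal_le_ofReal; nlinarith
          _ ≤ _ := ENNReal.ofReal_add_le
          _ ≤ _ := le_add_self
    refine lt_of_le_of_lt (lintegral_mono key) ?_
    rw [lintegral_add_left (by fun_prop), lintegral_add_left (by fun_prop)]
    exact ENNReal.add_lt_top.2 ⟨hA.lt_top, ENNReal.add_lt_top.2 ⟨hB.lt_top, hC.lt_top⟩⟩
  have : Integrable (fun ω => t * (f ω * g ω)) ν :=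
    ⟨by fun_prop, (hasFiniteIntegral_iff_norm _).2 hT⟩
  exact (integrable_const_mul_iff (IsUnit.mk0 t ht.ne') _).1 this

lemma iii_imp_ii {Ω : Type*} [MeasurableSpace Ω] (φ : ℝ → ℝ≥0∞)
    (hone : φ 1 = 0)
    (hdom : (1 : ℝ) ∈ interior {x : ℝ | φ x ≠ ⊤})
    (ν : Measure Ω) [IsProbabilityMeasure ν]
    (g : Ω → ℝ)
    (hiii : ∀ μ : Measure Ω, IsProbabilityMeasure μ → μ ≪ ν → divAC φ μ ν ≠ ⊤ →
          Integrable g μ)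
    (μ : Measure Ω) [IsFiniteMeasure μ] (hμ : μ ≪ ν) (hD : divAC φ μ ν ≠ ⊤) :
    Integrable g μ := by
  have hgν : Integrable g ν := by
    refine hiii ν inferInstance Measure.AbsolutelyContinuous.rfl ?_
    have : divAC φ ν ν = 0 := by
      unfold divAC
      rw [lintegral_congr_ae (g := fun _ => 0)]
      · simp
      · filter_upwards [Measure.rnDeriv_self ν] with ω hω
        simp [hω, hone]
    simp [this]
  set F := μ.rnDeriv ν with hF
  have hFm : Measurable F := Measure.measurable_rnDeriv μ ν
  set A : ℕ → Set Ω := fun n => {ω | (n : ℝ≥0∞) < F ω} with hA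
  have hAm : ∀ n, MeasurableSet (A n) := fun n => measurableSet_lt measurable_const hFm
  have hAa : Antitone A := by
    intro m n hmn ω hω
    exact lt_of_le_of_lt (by exact_mod_cast hmn) (show (n : ℝ≥0∞) < F ω from hω)
  have hAe : ν (⋂ n, A n) = 0 := by
    refine measure_mono_null ?_ (ae_iff.1 (Measure.rnDeriv_lt_top μ ν))
    intro ω hω hlt
    obtain ⟨n, hn⟩ := ENNReal.exists_nat_gt hlt.ne
    exact lt_asymm hn (mem_iInter.1 hω n)
  have hAν : Tendsto (fun n => ν (A n)) atTop (𝓝 0) := by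
    have := tendsto_measure_iInter_atTop (μ := ν) (fun n => (hAm n).nullMeasurableSet) hAa
      ⟨0, measure_ne_top _ _⟩
    rwa [hAe] at this
  have hAμ : Tendsto (fun n => μ (A n)) atTop (𝓝 0) := by
    have := tendsto_measure_iInter_atTop (μ := μ) (fun n => (hAm n).nullMeasurableSet) hAa
      ⟨0, measure_ne_top _ _⟩
    rwa [hμ hAe] at this
  have hAν' : Tendsto (fun n => ν.real (A n)) atTop (𝓝 0) := by
    have := (ENNReal.tendsto_toReal ENNReal.zero_ne_top).comp hAν
    rwa [ENNReal.toReal_zero] at this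
  have hAμ' : Tendsto (fun n => μ.real (A n)) atTop (𝓝 0) := by
    have := (ENNReal.tendsto_toReal ENNReal.zero_ne_top).comp hAμ
    rwa [ENNReal.toReal_zero] at this
  have hc : Tendsto (fun n => (1 - μ.real (A n)) / (1 - ν.real (A n))) atTop (𝓝 1) := by
    have := (hAμ'.const_sub 1).div (hAν'.const_sub 1) (by norm_num)
    rwa [sub_zero, div_one] at this
  have e1 : ∀ᶠ n in atTop, (1 - μ.real (A n)) / (1 - ν.real (A n)) ∈ {x : ℝ | φ x ≠ ⊤} :=
    hc.eventually (mem_interior_iff_mem_nhds.1 hdom)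
  have e2 : ∀ᶠ n in atTop, μ.real (A n) < 1 := hAμ'.eventually_lt_const one_pos
  have e3 : ∀ᶠ n in atTop, ν.real (A n) < 1 := hAν'.eventually_lt_const one_pos
  obtain ⟨n, h1, h2, h3⟩ := (e1.and (e2.and e3)).exists
  set c := (1 - μ.real (A n)) / (1 - ν.real (A n)) with hcdef
  have hc0 : 0 ≤ c := div_nonneg (by linarith) (by linarith)
  classical
  set H : Ω → ℝ≥0∞ := (A n).piecewise F (fun _ => ENNReal.ofReal c) with hH
  have hHm : Measurable H := Measurable.piecewise (hAm n) hFm measurable_const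
  have hHA : ∀ ω ∈ A n, H ω = F ω := fun ω h => by simp [hH, h]
  have hHA' : ∀ ω ∉ A n, H ω = ENNReal.ofReal c := fun ω h => by simp [hH, h]
  set μ' := ν.withDensity H with hμ'
  have hμF : ν.withDensity F = μ := Measure.withDensity_rnDeriv_eq μ ν hμ
  have hprob : IsProbabilityMeasure μ' := by
    constructor
    rw [hμ', withDensity_apply _ MeasurableSet.univ, Measure.restrict_univ,
      ← lintegral_add_compl _ (hAm n), setLIntegral_congr_fun (hAm n) hHA,
      setLIntegral_congr_fun (hAm n).compl hHA', ← withDensity_apply _ (hAm n), hμF,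
      setLIntegral_const, ← ofReal_measureReal (μ := μ), ← ofReal_measureReal (μ := ν),
      ← ENNReal.ofReal_mul hc0, ← ENNReal.ofReal_add (by positivity) (by positivity),
      probReal_compl_eq_one_sub (hAm n)]
    rw [hcdef, div_mul_cancel₀ _ (by linarith)]
    simp
  have hgμ' : Integrable g μ' := by
    refine hiii μ' hprob (withDensity_absolutelyContinuous _ _) ?_
    have : divAC φ μ' ν ≤ divAC φ μ ν + φ c := by
      unfold divAC
      calc _ ≤ ∫⁻ ω, (φ ((μ.rnDeriv ν ω).toReal) + φ c) ∂ν := by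
            refine lintegral_mono_ae ?_
            filter_upwards [Measure.rnDeriv_withDensity ν hHm] with ω hω
            rw [hω]
            by_cases h : ω ∈ A n
            · rw [hHA ω h]; exact le_self_add
            · rw [hHA' ω h, ENNReal.toReal_ofReal hc0]; exact le_add_self
        _ = _ := by rw [lintegral_add_right _ measurable_const]; simp
    exact ne_top_of_le_ne_top (ENNReal.add_ne_top.2 ⟨hD, h1⟩) this
  have hle : μ ≤ μ' + (n : ℝ≥0∞) • ν := by
    rw [← hμF, hμ', ← withDensity_const, ← withDensity_add_left hHm]
    refine withDensity_mono (Eventually.of_forall fun ω => ?_)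
    by_cases h : ω ∈ A n
    · simp only [Pi.add_apply, hHA ω h]; exact le_self_add
    · have : F ω ≤ n := not_lt.1 h
      exact this.trans le_add_self
  exact (hgμ'.add_measure (hgν.smul_measure (by simp))).mono_measure hle

lemma jensen_aux (φ : ℝ → ℝ≥0∞)
    (hconv : ∀ x y : ℝ, ∀ a b : ℝ≥0, a + b = 1 →
      φ ((a : ℝ) * x + (b : ℝ) * y) ≤ (a : ℝ≥0∞) * φ x + (b : ℝ≥0∞) * φ y)
    (hone : φ 1 = 0) (N : ℕ) : ∀ f : ℕ → ℝ,
    φ (∑ n ∈ Finset.range N, (1 / 2 : ℝ) ^ (n + 1) * f n + (1 / 2 : ℝ) ^ N) ≤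
      ∑ n ∈ Finset.range N, (2⁻¹ : ℝ≥0∞) ^ (n + 1) * φ (f n) := by
  induction N with
  | zero => intro f; simp [hone]
  | succ N ih =>
    intro f
    have h := hconv (f 0) (∑ n ∈ Finset.range N, (1 / 2 : ℝ) ^ (n + 1) * f (n + 1) + (1 / 2 : ℝ) ^ N)
      2⁻¹ 2⁻¹ (by rw [← two_mul]; exact mul_inv_cancel₀ two_ne_zero)
    have e : ((2⁻¹ : ℝ≥0) : ℝ) * f 0 + ((2⁻¹ : ℝ≥0) : ℝ) *
        (∑ n ∈ Finset.range N, (1 / 2 : ℝ) ^ (n + 1) * f (n + 1) + (1 / 2 : ℝ) ^ N) =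
        ∑ n ∈ Finset.range (N + 1), (1 / 2 : ℝ) ^ (n + 1) * f n + (1 / 2 : ℝ) ^ (N + 1) := by
      rw [Finset.sum_range_succ', mul_add, Finset.mul_sum]
      have : ∀ n, ((2⁻¹ : ℝ≥0) : ℝ) * ((1 / 2 : ℝ) ^ (n + 1) * f (n + 1)) =
        (1 / 2 : ℝ) ^ (n + 1 + 1) * f (n + 1) := by
        intro n; push_cast; ring
      simp_rw [this]
      push_cast
      ring
    rw [e] at h
    refine h.trans ?_
    rw [Finset.sum_range_succ', add_comm]
    have e2 : ((2⁻¹ : ℝ≥0) : ℝ≥0∞) = 2⁻¹ := by simp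
    rw [e2]
    refine add_le_add ?_ (by simp)
    refine (mul_le_mul_right (ih fun n => f (n + 1)) _).trans ?_
    rw [Finset.mul_sum]
    refine Finset.sum_le_sum fun n _ => ?_
    rw [pow_succ' _ (n + 1), mul_assoc]

lemma jensen_tsum (φ : ℝ → ℝ≥0∞)
    (hconv : ∀ x y : ℝ, ∀ a b : ℝ≥0, a + b = 1 →
      φ ((a : ℝ) * x + (b : ℝ) * y) ≤ (a : ℝ≥0∞) * φ x + (b : ℝ≥0∞) * φ y)
    (hlsc : LowerSemicontinuous φ)
    (hone : φ 1 = 0) (f : ℕ → ℝ) (hf : ∀ n, 0 ≤ f n)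
    (hfin : ∑' n, (2⁻¹ : ℝ≥0∞) ^ (n + 1) * ENNReal.ofReal (f n) ≠ ⊤) :
    φ (∑' n, (2⁻¹ : ℝ≥0∞) ^ (n + 1) * ENNReal.ofReal (f n)).toReal ≤
      ∑' n, (2⁻¹ : ℝ≥0∞) ^ (n + 1) * φ (f n) := by
  have hterm : ∀ n, ((2⁻¹ : ℝ≥0∞) ^ (n + 1) * ENNReal.ofReal (f n)).toReal =
      (1 / 2 : ℝ) ^ (n + 1) * f n := by
    intro n
    rw [ENNReal.toReal_mul, ENNReal.toReal_ofReal (hf n)]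
    simp
  have hsum := ENNReal.hasSum_toReal hfin
  simp_rw [hterm] at hsum
  rw [ENNReal.tsum_toReal_eq (ENNReal.ne_top_of_tsum_ne_top hfin)]
  simp_rw [hterm]
  have ht := hsum.tendsto_sum_nat.add
    (tendsto_pow_atTop_nhds_zero_of_lt_one (r := (1 / 2 : ℝ)) (by norm_num) (by norm_num))
  rw [add_zero] at ht
  refine le_of_forall_lt fun c hc => ?_
  obtain ⟨c', hc1, hc2⟩ := exists_between hc
  obtain ⟨N, hN⟩ := (ht.eventually (hlsc _ c' hc2)).exists
  exact hc1.trans (hN.trans_le ((jensen_aux φ hconv hone N f).trans (ENNReal.sum_le_tsum _)))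

lemma uniform_bound {Ω : Type*} [MeasurableSpace Ω] (φ : ℝ → ℝ≥0∞)
    (hconv : ∀ x y : ℝ, ∀ a b : ℝ≥0, a + b = 1 →
      φ ((a : ℝ) * x + (b : ℝ) * y) ≤ (a : ℝ≥0∞) * φ x + (b : ℝ≥0∞) * φ y)
    (hlsc : LowerSemicontinuous φ)
    (hone : φ 1 = 0)
    (ν : Measure Ω) [IsProbabilityMeasure ν]
    (g : Ω → ℝ) (hg : Measurable g)
    (hii : ∀ μ : Measure Ω, IsFiniteMeasure μ → μ ≪ ν → divAC φ μ ν ≠ ⊤ → Integrable g μ) :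
    ∃ M : ℝ, 0 < M ∧ ∀ f : Ω → ℝ, Measurable f → (∀ ω, 0 ≤ f ω) → ∫⁻ ω, φ (f ω) ∂ν ≤ 1 →
      ∫⁻ ω, ENNReal.ofReal (f ω) ∂ν ≤ 2 →
      ∫⁻ ω, ENNReal.ofReal (f ω) * ENNReal.ofReal |g ω| ∂ν ≤ ENNReal.ofReal M := by
  by_contra hcon
  push Not at hcon
  choose f hfm hf0 hfD hfI hfg using fun n : ℕ =>
    hcon ((2 : ℝ) ^ (n + 1) * (n + 1)) (by positivity)
  have hphi := hlsc.measurable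
  set F : Ω → ℝ≥0∞ := fun ω => ∑' n, (2⁻¹ : ℝ≥0∞) ^ (n + 1) * ENNReal.ofReal (f n ω) with hF
  have hFm : Measurable F := Measurable.tsum fun n => by have := hfm n; fun_prop
  have hFI : ∫⁻ ω, F ω ∂ν ≤ 2 := by
    rw [hF, lintegral_tsum (fun n => by have := hfm n; fun_prop)]
    calc _ = ∑' n, (2⁻¹ : ℝ≥0∞) ^ (n + 1) * ∫⁻ ω, ENNReal.ofReal (f n ω) ∂ν := by
          congr 1; ext n; rw [lintegral_const_mul _ (by have := hfm n; fun_prop)]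
      _ ≤ ∑' n, (2⁻¹ : ℝ≥0∞) ^ (n + 1) * 2 := by
          refine ENNReal.tsum_le_tsum fun n => ?_
          gcongr
          exact hfI n
      _ = 2 := by rw [ENNReal.tsum_mul_right, ENNReal.tsum_geometric_add_one,
            ENNReal.one_sub_inv_two, inv_inv, ENNReal.inv_mul_cancel, one_mul] <;> simp
  have hFfin : ∀ᵐ ω ∂ν, F ω < ⊤ := ae_lt_top hFm (ne_top_of_le_ne_top (by simp) hFI)
  have hfinm : IsFiniteMeasure (ν.withDensity F) :=
    isFiniteMeasure_withDensity (ne_top_of_le_ne_top (by simp) hFI)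
  have hD : divAC φ (ν.withDensity F) ν ≤ 1 := by
    unfold divAC
    calc _ ≤ ∫⁻ ω, ∑' n, (2⁻¹ : ℝ≥0∞) ^ (n + 1) * φ (f n ω) ∂ν := by
          refine lintegral_mono_ae ?_
          filter_upwards [Measure.rnDeriv_withDensity ν hFm, hFfin] with ω h1 h2
          rw [h1]
          exact jensen_tsum φ hconv hlsc hone (fun n => f n ω) (fun n => hf0 n ω) h2.ne
      _ = ∑' n, (2⁻¹ : ℝ≥0∞) ^ (n + 1) * ∫⁻ ω, φ (f n ω) ∂ν := by
          rw [lintegral_tsum (fun n => by have := hfm n; fun_prop)]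
          congr 1; ext n; rw [lintegral_const_mul _ (by have := hfm n; fun_prop)]
      _ ≤ ∑' n, (2⁻¹ : ℝ≥0∞) ^ (n + 1) * 1 := by
          refine ENNReal.tsum_le_tsum fun n => ?_
          gcongr
          exact hfD n
      _ = 1 := by
          rw [ENNReal.tsum_mul_right, ENNReal.tsum_geometric_add_one, mul_one]
          rw [ENNReal.one_sub_inv_two, inv_inv, ENNReal.inv_mul_cancel] <;> simp
  have hint := hii _ hfinm (withDensity_absolutelyContinuous _ _)
    (ne_top_of_le_ne_top ENNReal.one_ne_top hD)
  have hlt := (hasFiniteIntegral_iff_norm g).1 hint.2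
  rw [lintegral_withDensity_eq_lintegral_mul _ hFm (by fun_prop)] at hlt
  obtain ⟨n, hn⟩ := ENNReal.exists_nat_gt hlt.ne
  refine lt_irrefl _ (hn.trans_le ?_)
  calc (n : ℝ≥0∞) ≤ (2⁻¹ : ℝ≥0∞) ^ (n + 1) * ENNReal.ofReal ((2 : ℝ) ^ (n + 1) * (n + 1)) := by
        have : (2⁻¹ : ℝ≥0∞) = ENNReal.ofReal (1 / 2) := by
          rw [one_div, ENNReal.ofReal_inv_of_pos two_pos]; simp
        rw [this, ← ENNReal.ofReal_pow (by norm_num), ← ENNReal.ofReal_mul (by positivity),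
          ← mul_assoc, ← mul_pow]
        norm_num
        rw [← ENNReal.ofReal_natCast]
        exact ENNReal.ofReal_le_ofReal (by linarith)
    _ ≤ (2⁻¹ : ℝ≥0∞) ^ (n + 1) * ∫⁻ ω, ENNReal.ofReal (f n ω) * ENNReal.ofReal |g ω| ∂ν := by
        gcongr
        exact (hfg n).le
    _ = ∫⁻ ω, (2⁻¹ : ℝ≥0∞) ^ (n + 1) * (ENNReal.ofReal (f n ω) * ENNReal.ofReal |g ω|) ∂ν := by
        rw [lintegral_const_mul _ (by have := hfm n; fun_prop)]
    _ ≤ _ := by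
        refine lintegral_mono fun ω => ?_
        rw [← mul_assoc]
        simp only [Pi.mul_apply, Real.norm_eq_abs]
        gcongr
        exact ENNReal.le_tsum n

lemma selection {Ω : Type*} [MeasurableSpace Ω] (φ : ℝ → ℝ≥0∞)
    (hlsc : LowerSemicontinuous φ)
    (hone : φ 1 = 0) (h : Ω → ℝ) (hh : Measurable h)
    (s : Finset {q : ℚ // φ ((q : ℝ) + 1) ≠ ⊤}) :
    ∃ x : Ω → ℝ, Measurable x ∧ (∃ C : ℝ≥0, ∀ ω, |x ω| ≤ C ∧ φ (x ω + 1) ≤ C) ∧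
      (∀ ω, 0 ≤ x ω * h ω - (φ (x ω + 1)).toReal) ∧
      ∀ q ∈ s, ∀ ω, (q.1 : ℝ) * h ω - (φ ((q.1 : ℝ) + 1)).toReal ≤
        x ω * h ω - (φ (x ω + 1)).toReal := by
  classical
  have hphi := hlsc.measurable
  induction s using Finset.induction_on with
  | empty => exact ⟨fun _ => 0, measurable_const, ⟨0, by simp [hone]⟩, by simp [hone], by simp⟩
  | insert q s _ ih =>
    obtain ⟨x, hx, ⟨C, hC⟩, h0, hs⟩ := ih
    set B : Set Ω := {ω | x ω * h ω - (φ (x ω + 1)).toReal <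
      (q.1 : ℝ) * h ω - (φ ((q.1 : ℝ) + 1)).toReal} with hB
    have hBm : MeasurableSet B := measurableSet_lt (by fun_prop) (by fun_prop)
    refine ⟨B.piecewise (fun _ => (q.1 : ℝ)) x, Measurable.piecewise hBm measurable_const hx,
      ⟨C + (‖(q.1 : ℝ)‖₊ + (φ ((q.1 : ℝ) + 1)).toNNReal), fun ω => ?_⟩, fun ω => ?_,
      fun p hp ω => ?_⟩
    · by_cases hω : ω ∈ B
      · rw [Set.piecewise_eq_of_mem _ _ _ hω]
        push_cast
        rw [ENNReal.coe_toNNReal q.2]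
        refine ⟨?_, ?_⟩
        · have := C.2
          have h2 : (0 : ℝ) ≤ ((φ ((q.1 : ℝ) + 1)).toNNReal : ℝ) := NNReal.coe_nonneg _
          rw [Real.norm_eq_abs]
          have h3 : (0 : ℝ) ≤ (C : ℝ) := C.2
          have h4 : (0 : ℝ) ≤ (φ ((q.1 : ℝ) + 1)).toReal := h2
          linarith
        · exact le_add_self.trans le_add_self
      · rw [Set.piecewise_eq_of_notMem _ _ _ hω]
        refine ⟨(hC ω).1.trans ?_, (hC ω).2.trans ?_⟩
        · exact_mod_cast le_self_add
        · exact_mod_cast le_self_add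
    · by_cases hω : ω ∈ B
      · rw [Set.piecewise_eq_of_mem _ _ _ hω]
        exact (h0 ω).trans (le_of_lt hω)
      · rw [Set.piecewise_eq_of_notMem _ _ _ hω]
        exact h0 ω
    · rw [Finset.mem_insert] at hp
      by_cases hω : ω ∈ B
      · rw [Set.piecewise_eq_of_mem _ _ _ hω]
        rcases hp with rfl | hp
        · exact le_rfl
        · exact (hs p hp ω).trans (le_of_lt hω)
      · rw [Set.piecewise_eq_of_notMem _ _ _ hω]
        rcases hp with rfl | hp
        · exact not_lt.1 hω
        · exact hs p hp ω

lemma value_bound {Ω : Type*} [MeasurableSpace Ω] (φ : ℝ → ℝ≥0∞)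
    (hconv : ∀ x y : ℝ, ∀ a b : ℝ≥0, a + b = 1 →
      φ ((a : ℝ) * x + (b : ℝ) * y) ≤ (a : ℝ≥0∞) * φ x + (b : ℝ≥0∞) * φ y)
    (hlsc : LowerSemicontinuous φ)
    (hneg : ∀ x : ℝ, x < 0 → φ x = ⊤)
    (hone : φ 1 = 0)
    (ν : Measure Ω) [IsProbabilityMeasure ν]
    (g : Ω → ℝ) (hgi : Integrable g ν) (M : ℝ) (hM : 0 < M)
    (hb : ∀ f : Ω → ℝ, Measurable f → (∀ ω, 0 ≤ f ω) → ∫⁻ ω, φ (f ω) ∂ν ≤ 1 →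
      ∫⁻ ω, ENNReal.ofReal (f ω) ∂ν ≤ 2 →
      ∫⁻ ω, ENNReal.ofReal (f ω) * ENNReal.ofReal |g ω| ∂ν ≤ ENNReal.ofReal M)
    (x : Ω → ℝ) (hx : Measurable x) (C : ℝ≥0) (hC : ∀ ω, |x ω| ≤ C ∧ φ (x ω + 1) ≤ C)
    (h0 : ∀ ω, 0 ≤ x ω * (|g ω| / M - 1) - (φ (x ω + 1)).toReal) :
    ∫⁻ ω, ENNReal.ofReal (x ω * (|g ω| / M - 1) - (φ (x ω + 1)).toReal) ∂ν ≤ 2 := by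
  have hphi := hlsc.measurable
  have hfin : ∀ ω, φ (x ω + 1) ≠ ⊤ := fun ω => ne_top_of_le_ne_top ENNReal.coe_ne_top (hC ω).2
  have hf0 : ∀ ω, 0 ≤ x ω + 1 := fun ω => by
    by_contra h; exact hfin ω (hneg _ (by linarith))
  have hxi : Integrable x ν := Integrable.of_bound hx.aestronglyMeasurable (C : ℝ)
    (Eventually.of_forall fun ω => (hC ω).1)
  have hpi : Integrable (fun ω => (φ (x ω + 1)).toReal) ν :=
    Integrable.of_bound
      (hphi.comp (hx.add_const 1)).ennreal_toReal.aestronglyMeasurable (C : ℝ) (Eventually.of_forall fun ω => by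
      rw [Real.norm_eq_abs, abs_of_nonneg ENNReal.toReal_nonneg]
      exact ENNReal.toReal_mono ENNReal.coe_ne_top (hC ω).2)
  have hfi : Integrable (fun ω => x ω + 1) ν := hxi.add (integrable_const 1)
  have hxg : Integrable (fun ω => x ω * |g ω|) ν :=
    hgi.abs.bdd_mul hx.aestronglyMeasurable (Eventually.of_forall fun ω => (hC ω).1)
  have hfg : Integrable (fun ω => (x ω + 1) * |g ω|) ν := by
    have : (fun ω => (x ω + 1) * |g ω|) = fun ω => x ω * |g ω| + |g ω| := by ext; ring
    rw [this]; exact hxg.add hgi.abs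
  set A := ∫ ω, (φ (x ω + 1)).toReal ∂ν with hA
  set B := ∫ ω, (x ω + 1) ∂ν with hB
  have hA0 : 0 ≤ A := integral_nonneg fun ω => ENNReal.toReal_nonneg
  have hB0 : 0 ≤ B := integral_nonneg hf0
  set s := 1 / (1 + A + B) with hs
  have hs0 : 0 < s := by positivity
  have hs1 : s ≤ 1 := by rw [hs, div_le_one (by positivity)]; linarith
  have hsA : s * A ≤ 1 := by rw [hs, one_div_mul_eq_div, div_le_one (by positivity)]; linarith
  have hsB : s * B ≤ 1 := by rw [hs, one_div_mul_eq_div, div_le_one (by positivity)]; linarith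
  have hsf0 : ∀ ω, 0 ≤ s * (x ω + 1) + (1 - s) := fun ω => by
    have := mul_nonneg hs0.le (hf0 ω); linarith
  have key := hb (fun ω => s * (x ω + 1) + (1 - s)) (by fun_prop) hsf0 (by
    calc _ ≤ ∫⁻ ω, ENNReal.ofReal (s * (φ (x ω + 1)).toReal) ∂ν := by
          refine lintegral_mono fun ω => ?_
          refine (phi_scale φ hconv hone s (x ω + 1) hs0.le hs1).trans ?_
          rw [ENNReal.ofReal_mul hs0.le, ENNReal.ofReal_toReal (hfin ω)]
      _ = ENNReal.ofReal (s * A) := by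
          rw [← ofReal_integral_eq_lintegral_ofReal (hpi.const_mul s)
            (Eventually.of_forall fun ω => mul_nonneg hs0.le ENNReal.toReal_nonneg),
            integral_const_mul]
      _ ≤ 1 := by simpa using hsA) (by
    rw [← ofReal_integral_eq_lintegral_ofReal (f := fun ω => s * (x ω + 1) + (1 - s))
      ((hfi.const_mul s).add (integrable_const _)) (Eventually.of_forall hsf0), integral_add (hfi.const_mul s) (integrable_const _),
      integral_const_mul, integral_const]
    simp only [probReal_univ, one_smul]
    rw [← hB, show (2 : ℝ≥0∞) = ENNReal.ofReal 2 by simp]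
    exact ENNReal.ofReal_le_ofReal (by linarith))
  have key2 : ENNReal.ofReal (s * ∫ ω, (x ω + 1) * |g ω| ∂ν) ≤ ENNReal.ofReal M := by
    refine le_trans ?_ key
    rw [← integral_const_mul, ofReal_integral_eq_lintegral_ofReal (hfg.const_mul s)
      (Eventually.of_forall fun ω => mul_nonneg hs0.le (mul_nonneg (hf0 ω) (abs_nonneg _)))]
    refine lintegral_mono fun ω => ?_
    rw [← ENNReal.ofReal_mul (hsf0 ω)]
    apply ENNReal.ofReal_le_ofReal
    have := mul_nonneg (sub_nonneg.2 hs1) (abs_nonneg (g ω))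
    nlinarith
  rw [ENNReal.ofReal_le_ofReal_iff hM.le, hs, one_div_mul_eq_div,
    div_le_iff₀ (by positivity)] at key2
  have hdec : (fun ω => x ω * (|g ω| / M - 1) - (φ (x ω + 1)).toReal) =
      fun ω => (((M⁻¹ * ((x ω + 1) * |g ω|) - (x ω + 1)) - (φ (x ω + 1)).toReal)
        - M⁻¹ * |g ω|) + 1 := by
    ext ω; field_simp; ring
  have i1 := hfg.const_mul M⁻¹
  have i2 := i1.sub hfi
  have i3 := i2.sub hpi
  have i4 := i3.sub (hgi.abs.const_mul M⁻¹)
  have hint : Integrable (fun ω => x ω * (|g ω| / M - 1) - (φ (x ω + 1)).toReal) ν := by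
    rw [hdec]; exact i4.add (integrable_const 1)
  rw [← ofReal_integral_eq_lintegral_ofReal hint (Eventually.of_forall h0),
    show (2 : ℝ≥0∞) = ENNReal.ofReal 2 by simp]
  apply ENNReal.ofReal_le_ofReal
  have hval : ∫ ω, (x ω * (|g ω| / M - 1) - (φ (x ω + 1)).toReal) ∂ν =
      (((M⁻¹ * ∫ ω, ((x ω + 1) * |g ω|) ∂ν) - B) - A) - M⁻¹ * ∫ ω, |g ω| ∂ν + 1 := by
    rw [hdec, integral_add (by exact i4) (integrable_const 1), integral_sub (by exact i3)
      (hgi.abs.const_mul M⁻¹), integral_sub (by exact i2) hpi, integral_sub i1 hfi,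
      integral_const_mul, integral_const_mul, ← hA, ← hB]
    simp
  rw [hval]
  have h1 : M⁻¹ * ∫ ω, ((x ω + 1) * |g ω|) ∂ν ≤ 1 + A + B := by
    rw [inv_mul_le_iff₀ hM]; exact key2
  have h2 : 0 ≤ M⁻¹ * ∫ ω, |g ω| ∂ν :=
    mul_nonneg (by positivity) (integral_nonneg fun ω => abs_nonneg _)
  linarith

lemma ii_imp_i {Ω : Type*} [MeasurableSpace Ω] (φ : ℝ → ℝ≥0∞)
    (hconv : ∀ x y : ℝ, ∀ a b : ℝ≥0, a + b = 1 →
      φ ((a : ℝ) * x + (b : ℝ) * y) ≤ (a : ℝ≥0∞) * φ x + (b : ℝ≥0∞) * φ y)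
    (hlsc : LowerSemicontinuous φ)
    (hneg : ∀ x : ℝ, x < 0 → φ x = ⊤)
    (hone : φ 1 = 0)
    (ν : Measure Ω) [IsProbabilityMeasure ν]
    (g : Ω → ℝ) (hg : Measurable g)
    (hii : ∀ μ : Measure Ω, IsFiniteMeasure μ → μ ≪ ν → divAC φ μ ν ≠ ⊤ → Integrable g μ) :
    ∃ δ : ℝ, 0 < δ ∧ ∀ t : ℝ, |t| < δ → cgf φ ν g t ≠ ⊤ := by
  have hgν : Integrable g ν := by
    refine hii ν inferInstance Measure.AbsolutelyContinuous.rfl ?_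
    have : divAC φ ν ν = 0 := by
      unfold divAC
      rw [lintegral_congr_ae (g := fun _ => 0)]
      · simp
      · filter_upwards [Measure.rnDeriv_self ν] with ω hω
        simp [hω, hone]
    simp [this]
  obtain ⟨M, hM, hb⟩ := uniform_bound φ hconv hlsc hone ν g hg hii
  have hpsi : ∫⁻ ω, psiStar φ (|g ω| / M - 1) ∂ν ≤ 2 := by
    have e : ∀ ω, psiStar φ (|g ω| / M - 1) =
        ⨆ s : Finset {q : ℚ // φ ((q : ℝ) + 1) ≠ ⊤}, ⨆ q ∈ s,
          ENNReal.ofReal ((q.1 : ℝ) * (|g ω| / M - 1) - (φ ((q.1 : ℝ) + 1)).toReal) := by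
      intro ω
      rw [psiStar_rat φ hconv hone, iSup_eq_iSup_finset]
    simp_rw [e]
    rw [lintegral_iSup_directed]
    · refine iSup_le fun s => ?_
      obtain ⟨x, hx, ⟨C, hC⟩, h0, hs⟩ := selection φ hlsc hone (fun ω => |g ω| / M - 1)
        (by fun_prop) s
      refine le_trans (lintegral_mono fun ω => ?_)
        (value_bound φ hconv hlsc hneg hone ν g hgν M hM hb x hx C hC h0)
      exact iSup₂_le fun q hq => ENNReal.ofReal_le_ofReal (hs q hq ω)
    · intro s
      exact (Measurable.biSup _ s.countable_toSet fun q _ => by fun_prop).aemeasurable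
    · refine Monotone.directed_le fun s t hst ω => ?_
      exact biSup_mono fun q hq => hst hq
  refine ⟨1 / M, by positivity, fun t ht => ?_⟩
  refine ne_top_of_le_ne_top ?_ (iInf_le _ (-1 : ℝ))
  have key : ∀ ω, psiStar φ (t * g ω + -1) ≤
      psiStar φ (|g ω| / M - 1) + ENNReal.ofReal (|g ω| / M + 1) := by
    intro ω
    have h1 : |t * g ω| ≤ |g ω| / M := by
      rw [abs_mul, div_eq_inv_mul, ← one_div]
      exact mul_le_mul_of_nonneg_right ht.le (abs_nonneg _)
    have h2 := abs_le.1 h1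
    rcases le_total (t * g ω + -1) 0 with h | h
    · refine le_trans (psiStar_nonpos φ hneg _ h) (le_trans ?_ le_add_self)
      apply ENNReal.ofReal_le_ofReal
      rw [abs_of_nonpos h]; linarith
    · exact le_trans (psiStar_mono_of_nonneg φ _ _ h (by linarith)) le_self_add
  refine ne_top_of_le_ne_top ?_ (lintegral_mono key)
  rw [lintegral_add_right _ (by fun_prop)]
  refine ENNReal.add_ne_top.2 ⟨ne_top_of_le_ne_top (by simp) hpsi, ?_⟩
  exact ((hgν.abs.div_const M).add (integrable_const 1)).lintegral_lt_top.ne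

/-- **Subexponential functions are exactly the functions integrable with respect to every
measure of finite φ-divergence.**  For a probability measure `ν` and measurable `g`, the
following are equivalent: (i) `Λ_{g,ν}` is finite on a neighborhood of `0`; (ii) `g` is
`μ`-integrable for every finite nonnegative `μ ≪ ν` with `D_φ(μ‖ν) < ∞`; (iii) `g` is
`μ`-integrable for every probability measure `μ ≪ ν` with `D_φ(μ‖ν) < ∞`. -/
theorem subexponential_iff_integrable {Ω : Type*} [MeasurableSpace Ω] (φ : ℝ → ℝ≥0∞)
    (hconv : ∀ x y : ℝ, ∀ a b : ℝ≥0, a + b = 1 →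
      φ ((a : ℝ) * x + (b : ℝ) * y) ≤ (a : ℝ≥0∞) * φ x + (b : ℝ≥0∞) * φ y)
    (hlsc : LowerSemicontinuous φ)
    (hneg : ∀ x : ℝ, x < 0 → φ x = ⊤)
    (hone : φ 1 = 0)
    (hdom : (1 : ℝ) ∈ interior {x : ℝ | φ x ≠ ⊤})
    (ν : Measure Ω) [IsProbabilityMeasure ν]
    (g : Ω → ℝ) (hg : Measurable g) :
    ((∃ δ : ℝ, 0 < δ ∧ ∀ t : ℝ, |t| < δ → cgf φ ν g t ≠ ⊤)
      ↔ (∀ μ : Measure Ω, IsFiniteMeasure μ → μ ≪ ν → divAC φ μ ν ≠ ⊤ → Integrable g μ))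
    ∧ ((∀ μ : Measure Ω, IsFiniteMeasure μ → μ ≪ ν → divAC φ μ ν ≠ ⊤ → Integrable g μ)
      ↔ (∀ μ : Measure Ω, IsProbabilityMeasure μ → μ ≪ ν → divAC φ μ ν ≠ ⊤ →
          Integrable g μ)) := by
  refine ⟨⟨fun hi μ hμf hμ hD => ?_, fun hii => ?_⟩, ⟨fun hii μ hμp hμ hD => ?_, fun hiii μ hμf hμ hD => ?_⟩⟩
  · exact i_imp_ii φ hlsc hdom ν g hg hi μ hμ hD
  · exact ii_imp_i φ hconv hlsc hneg hone ν g hg hii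
  · exact hii μ inferInstance hμ hD
  · exact iii_imp_ii φ hone hdom ν g hiii μ hμ hD
end

section
/- Let ν be a probability measure on (Ω,F), g ∈ L¹(ν), and M a convex set of probability measures with ν ∈ M and g ∈ L¹(μ) for every μ ∈ M. Define L(ε) := inf{ D_φ(μ‖ν) : μ ∈ M and ∫ g dμ − ∫ g dν = ε } ∈ [0,∞] (inf ∅ = +∞), and L*(t) := sup_{ε∈ℝ} (t·ε − L(ε)). The following are equivalent: (i) for every sequence (ν_n) in M with D_φ(ν_n‖ν) → 0, one has ∫ g dν_n → ∫ g dν; (ii) L(ε) = 0 if and only if ε = 0; (iii) { x ∈ ℝ : for all t ∈ ℝ, L*(t) ≥ t·x } = {0} (i.e., the subdifferential of L* at 0 is {0}, equivalently L* is differentiable at 0 with derivative 0). -/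
open MeasureTheory Filter Set
open scoped ENNReal NNReal Topology

/-- The φ-divergence `D_φ(μ‖ν) = ∫ φ(dμ_c/dν) dν + φ'(∞)·μ_s(Ω)`, where
`μ = μ_c + μ_s` is the Lebesgue decomposition of `μ` with respect to `ν` and
`dphi = φ'(∞)`; the convention `0·∞ = 0` is automatic in `ℝ≥0∞`. -/
noncomputable def divFull {Ω : Type*} [MeasurableSpace Ω] (φ : ℝ → ℝ≥0∞)
    (dphi : ℝ≥0∞) (μ ν : Measure Ω) : ℝ≥0∞ :=
  ∫⁻ ω, φ ((μ.rnDeriv ν ω).toReal) ∂ν + dphi * μ.singularPart ν Set.univ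

lemma div_scale {Ω : Type*} [MeasurableSpace Ω] (φ : ℝ → ℝ≥0∞)
    (hconv : ∀ x y : ℝ, ∀ a b : ℝ≥0, a + b = 1 →
      φ ((a : ℝ) * x + (b : ℝ) * y) ≤ (a : ℝ≥0∞) * φ x + (b : ℝ≥0∞) * φ y)
    (hone : φ 1 = 0) (dphi : ℝ≥0∞) (μ ν : Measure Ω) [IsProbabilityMeasure ν]
    [IsProbabilityMeasure μ] (a b : ℝ≥0) (hab : a + b = 1) :
    divFull φ dphi (a • μ + b • ν) ν ≤ a * divFull φ dphi μ ν := by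
  unfold divFull
  rw [mul_add, ← lintegral_const_mul' _ _ ENNReal.coe_ne_top]
  refine add_le_add (lintegral_mono_ae ?_) ?_
  · filter_upwards [Measure.rnDeriv_add (a • μ) (b • ν) ν, Measure.rnDeriv_smul_left μ ν a,
      Measure.rnDeriv_smul_left ν ν b, Measure.rnDeriv_self ν,
      Measure.rnDeriv_lt_top μ ν] with ω h1 h2 h3 h4 h5
    have h : ((a • μ + b • ν).rnDeriv ν ω).toReal
        = (a : ℝ) * (μ.rnDeriv ν ω).toReal + (b : ℝ) * 1 := by
      rw [h1, Pi.add_apply, h2, h3, Pi.smul_apply, Pi.smul_apply, h4]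
      simp only [ENNReal.smul_def, smul_eq_mul]
      rw [ENNReal.toReal_add (ENNReal.mul_ne_top ENNReal.coe_ne_top h5.ne) (by simp)]
      simp
    rw [h]
    refine (hconv _ _ a b hab).trans ?_
    simp [hone]
  · rw [Measure.singularPart_add, Measure.singularPart_smul, Measure.singularPart_smul,
      Measure.singularPart_self]
    simp only [smul_zero, add_zero, Measure.smul_apply, ENNReal.smul_def, smul_eq_mul]
    rw [mul_left_comm]

/-- **Convergence in φ-divergence implies convergence of means iff the optimal lower
bound is strictly convex at `0`, iff the conjugate has subdifferential `{0}` at `0`.**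
Let `ν` be a probability measure, `g ∈ L¹(ν)`, and `M` a convex set of probability
measures containing `ν` and integrating `g`.  With
`L(ε) = inf { D_φ(μ‖ν) : μ ∈ M, ∫ g dμ − ∫ g dν = ε }` and
`L*(t) = sup_ε (t·ε − L(ε))`, the following are equivalent:
(i) `∫ g dν_n → ∫ g dν` whenever `(ν_n) ⊆ M` and `D_φ(ν_n‖ν) → 0`;
(ii) `L(ε) = 0 ↔ ε = 0`;
(iii) `{x : ∀ t, t·x ≤ L*(t)} = {0}`. -/
theorem convergence_iff_strictly_convex_iff_subdiff {Ω : Type*} [MeasurableSpace Ω]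
    (φ : ℝ → ℝ≥0∞)
    (hconv : ∀ x y : ℝ, ∀ a b : ℝ≥0, a + b = 1 →
      φ ((a : ℝ) * x + (b : ℝ) * y) ≤ (a : ℝ≥0∞) * φ x + (b : ℝ≥0∞) * φ y)
    (hlsc : LowerSemicontinuous φ)
    (hneg : ∀ x : ℝ, x < 0 → φ x = ⊤)
    (hone : φ 1 = 0)
    (hdom : (1 : ℝ) ∈ interior {x : ℝ | φ x ≠ ⊤})
    (dphi : ℝ≥0∞)
    (hdphi : Tendsto (fun x : ℝ => φ x / ENNReal.ofReal x) atTop (𝓝 dphi))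
    (ν : Measure Ω) [IsProbabilityMeasure ν]
    (g : Ω → ℝ) (hg : Measurable g) (hgν : Integrable g ν)
    (M : Set (Measure Ω)) (hνM : ν ∈ M)
    (hMprob : ∀ μ ∈ M, IsProbabilityMeasure μ)
    (hMint : ∀ μ ∈ M, Integrable g μ)
    (hMconv : ∀ μ₁ ∈ M, ∀ μ₂ ∈ M, ∀ a b : ℝ≥0, a + b = 1 →
      (a • μ₁ + b • μ₂ : Measure Ω) ∈ M)
    (L : ℝ → ℝ≥0∞)
    (hL : ∀ ε : ℝ, L ε =
      ⨅ (μ : Measure Ω) (_ : μ ∈ M ∧ ∫ ω, g ω ∂μ - ∫ ω, g ω ∂ν = ε), divFull φ dphi μ ν)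
    (Lstar : ℝ → EReal)
    (hLstar : ∀ t : ℝ, Lstar t = ⨆ ε : ℝ, ((t * ε : ℝ) : EReal) - ((L ε : ℝ≥0∞) : EReal)) :
    ((∀ s : ℕ → Measure Ω, (∀ n, s n ∈ M) →
        Tendsto (fun n => divFull φ dphi (s n) ν) atTop (𝓝 0) →
        Tendsto (fun n => ∫ ω, g ω ∂(s n)) atTop (𝓝 (∫ ω, g ω ∂ν)))
      ↔ (∀ ε : ℝ, L ε = 0 ↔ ε = 0))
    ∧ ((∀ ε : ℝ, L ε = 0 ↔ ε = 0)
      ↔ {x : ℝ | ∀ t : ℝ, ((t * x : ℝ) : EReal) ≤ Lstar t} = {0}) := by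
  have hν0 : divFull φ dphi ν ν = 0 := by
    have := div_scale φ hconv hone dphi ν ν 0 1 (by simp)
    simpa using this
  have hscale : ∀ μ ∈ M, ∀ a : ℝ, 0 ≤ a → a ≤ 1 →
      L (a * (∫ ω, g ω ∂μ - ∫ ω, g ω ∂ν)) ≤ ENNReal.ofReal a * divFull φ dphi μ ν := by
    intro μ hμ a ha0 ha1
    have := hMprob μ hμ
    have hab : a.toNNReal + (1 - a).toNNReal = 1 := by
      rw [← Real.toNNReal_add ha0 (by linarith)]; simp
    rw [hL]
    refine (iInf₂_le (a.toNNReal • μ + (1 - a).toNNReal • ν)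
      ⟨hMconv μ hμ ν hνM _ _ hab, ?_⟩).trans (div_scale φ hconv hone dphi μ ν _ _ hab)
    rw [integral_add_measure ((hMint μ hμ).smul_measure_nnreal) (hgν.smul_measure_nnreal),
      integral_smul_nnreal_measure, integral_smul_nnreal_measure]
    simp only [NNReal.smul_def, smul_eq_mul, Real.coe_toNNReal a ha0,
      Real.coe_toNNReal (1 - a) (by linarith)]
    ring
  have hLscale : ∀ ε : ℝ, ∀ a : ℝ, 0 ≤ a → a ≤ 1 → L (a * ε) ≤ ENNReal.ofReal a * L ε := by
    intro ε a ha0 ha1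
    rcases ha0.eq_or_lt with rfl | hpos
    · have := hscale ν hνM 0 le_rfl zero_le_one
      simpa using this
    · have hne : ENNReal.ofReal a ≠ 0 := by simpa using hpos
      rw [mul_comm (ENNReal.ofReal a), ← ENNReal.div_le_iff hne ENNReal.ofReal_ne_top, hL ε]
      refine le_iInf₂ fun μ hμ => ?_
      rw [ENNReal.div_le_iff hne ENNReal.ofReal_ne_top, mul_comm (divFull _ _ _ _), ← hμ.2]
      exact hscale μ hμ.1 a ha0 ha1
  have hL0 : L 0 = 0 := by
    have := hLscale 0 0 le_rfl zero_le_one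
    simpa using this
  -- monotonicity along rays
  have key : ∀ μ ∈ M, ∀ δ : ℝ, ∀ a : ℝ, 0 ≤ a → a ≤ 1 →
      a * (∫ ω, g ω ∂μ - ∫ ω, g ω ∂ν) = δ → L δ ≤ divFull φ dphi μ ν := by
    intro μ hμ δ a ha0 ha1 h
    rw [← h]
    refine (hscale μ hμ a ha0 ha1).trans ?_
    calc _ ≤ 1 * divFull φ dphi μ ν := by gcongr; simpa using ha1
      _ = _ := one_mul _
  refine ⟨⟨fun h ε => ⟨fun hε => ?_, fun hε => hε ▸ hL0⟩, fun h s hs hD => ?_⟩,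
    ⟨fun h => ?_, fun h ε => ⟨fun hε => ?_, fun hε => hε ▸ hL0⟩⟩⟩
  · have hex : ∀ n : ℕ, ∃ μ : Measure Ω, (μ ∈ M ∧ ∫ ω, g ω ∂μ - ∫ ω, g ω ∂ν = ε) ∧
        divFull φ dphi μ ν < ((n : ℝ≥0∞) + 1)⁻¹ := by
      intro n
      have : L ε < ((n : ℝ≥0∞) + 1)⁻¹ := by
        rw [hε]; exact ENNReal.inv_pos.2 (by finiteness)
      rw [hL] at this
      obtain ⟨μ, hμ⟩ := iInf_lt_iff.1 this
      obtain ⟨h1, h2⟩ := iInf_lt_iff.1 hμ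
      exact ⟨μ, h1, h2⟩
    choose s hs hs2 using hex
    have hlim : Tendsto (fun n => divFull φ dphi (s n) ν) atTop (𝓝 0) := by
      refine tendsto_of_tendsto_of_tendsto_of_le_of_le tendsto_const_nhds
        ENNReal.tendsto_inv_nat_nhds_zero (fun n => zero_le) (fun n => (hs2 n).le.trans ?_)
      exact ENNReal.inv_le_inv.2 le_self_add
    have h1 := h s (fun n => (hs n).1) hlim
    have h2 : (fun n => ∫ ω, g ω ∂(s n)) = fun _ => ∫ ω, g ω ∂ν + ε := by
      funext n; linarith [(hs n).2]
    rw [h2] at h1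
    have := tendsto_nhds_unique h1 tendsto_const_nhds
    linarith
  · rw [Metric.tendsto_nhds]
    intro δ hδ
    have p1 : 0 < L δ := pos_iff_ne_zero.2 fun h0 => hδ.ne' ((h δ).1 h0)
    have p2 : 0 < L (-δ) := pos_iff_ne_zero.2 fun h0 => by
      have := (h (-δ)).1 h0; linarith
    filter_upwards [hD.eventually (gt_mem_nhds p1), hD.eventually (gt_mem_nhds p2)] with n h1 h2
    rw [Real.dist_eq]
    by_contra! hc
    rcases le_abs'.1 hc with hc | hc
    · have hn : ∫ ω, g ω ∂(s n) - ∫ ω, g ω ∂ν < 0 := by linarith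
      refine (key (s n) (hs n) (-δ) (-δ / (∫ ω, g ω ∂(s n) - ∫ ω, g ω ∂ν)) ?_ ?_ ?_).not_gt h2
      · exact div_nonneg_of_nonpos (by linarith) hn.le
      · rw [div_le_one_of_neg hn]; exact hc
      · exact div_mul_cancel₀ _ hn.ne
    · have hn : 0 < ∫ ω, g ω ∂(s n) - ∫ ω, g ω ∂ν := by linarith
      refine (key (s n) (hs n) δ (δ / (∫ ω, g ω ∂(s n) - ∫ ω, g ω ∂ν)) ?_ ?_ ?_).not_gt h1
      · exact div_nonneg hδ.le hn.le
      · rw [div_le_one hn]; exact hc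
      · exact div_mul_cancel₀ _ hn.ne'
  · ext x
    simp only [mem_setOf_eq, mem_singleton_iff]
    constructor
    · intro hx
      by_contra hx0
      have hpos : L (x / 2) ≠ 0 := fun h0 => hx0 (by linarith [(h (x / 2)).1 h0])
      obtain ⟨c, hc0, hcL⟩ := ENNReal.lt_iff_exists_nnreal_btwn.1 (pos_iff_ne_zero.2 hpos)
      have hc0' : (0 : ℝ) < c := by exact_mod_cast hc0
      have htx : (2 * c / x) * x = 2 * c := by field_simp
      have hle : Lstar (2 * c / x) ≤ ((c : ℝ) : EReal) := by
        rw [hLstar]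
        refine iSup_le fun ε => ?_
        rcases le_total (2 * c / x * ε) c with hε | hε
        · calc _ ≤ ((2 * c / x * ε : ℝ) : EReal) - 0 := by
                apply EReal.sub_le_sub le_rfl; exact EReal.coe_ennreal_nonneg _
            _ ≤ _ := by simpa using EReal.coe_le_coe_iff.2 hε
        · set u : ℝ := 2 * c / x * ε with hu
          have hu0 : 0 < u := hc0'.trans_le hε
          have hxe : (c / u) * ε = x / 2 := by
            have : ε ≠ 0 := by rintro rfl; simp [hu] at hu0
            rw [hu]; field_simp
          have h1 := hLscale ε (c / u) (by positivity) ((div_le_one hu0).2 hε)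
          rw [hxe] at h1
          have h2 : ENNReal.ofReal u ≤ L ε := by
            by_contra! hlt
            have h3 : ENNReal.ofReal (c / u) * L ε ≤ c := by
              calc _ ≤ ENNReal.ofReal (c / u) * ENNReal.ofReal u := by gcongr
                _ = c := by
                  rw [← ENNReal.ofReal_mul (by positivity), div_mul_cancel₀ _ hu0.ne']; simp
            exact (hcL.trans_le (h1.trans h3)).false
          have h4 : ((u : ℝ) : EReal) ≤ (L ε : EReal) := by
            have := EReal.coe_ennreal_le_coe_ennreal_iff.2 h2
            rwa [EReal.coe_ennreal_ofReal, max_eq_left hu0.le] at this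
          calc _ ≤ ((u : ℝ) : EReal) - ((u : ℝ) : EReal) := EReal.sub_le_sub le_rfl h4
            _ = ((u - u : ℝ) : EReal) := (EReal.coe_sub _ _).symm
            _ ≤ _ := by rw [sub_self]; exact EReal.coe_le_coe_iff.2 hc0'.le
      have := (hx (2 * c / x)).trans hle
      rw [htx, EReal.coe_le_coe_iff] at this
      linarith
    · rintro rfl t
      rw [hLstar]
      refine le_iSup_of_le 0 ?_
      simp [hL0]
  · have : ε ∈ {x : ℝ | ∀ t : ℝ, ((t * x : ℝ) : EReal) ≤ Lstar t} := by
      intro t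
      rw [hLstar]
      refine le_iSup_of_le ε ?_
      simp [hε]
    rw [h] at this
    exact this
end

section
/- Suppose there exists A ∈ F with A ≠ ∅ and A ≠ Ω. Then for every t ≥ 0: sup{ Λ_{g,ν}(t) : ν a probability measure on (Ω,F) and g : Ω → ℝ measurable with |g| ≤ 1 everywhere } = inf_{λ∈ℝ} max( ψ*(λ + t), ψ*(λ − t) ). -/
open MeasureTheory Filter Set
open scoped ENNReal NNReal Topology

lemma psiStar_le_ofReal (φ : ℝ → ℝ≥0∞) (y u : ℝ) (hu : 0 ≤ u) :
    psiStar φ y ≤ ENNReal.ofReal u ↔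
      ∀ x : ℝ, φ (x + 1) ≠ ⊤ → x * y ≤ u + (φ (x + 1)).toReal := by
  have h1 : psiStar φ y ≤ ENNReal.ofReal u ↔
      (⨆ x : ℝ, ((x * y : ℝ) : EReal) - ((φ (x + 1) : ℝ≥0∞) : EReal)) ≤ (u : EReal) := by
    unfold psiStar
    rw [erealToENNReal_eq]
    constructor
    · intro h
      have h' := EReal.coe_ennreal_le_coe_ennreal_iff.2 h
      have h2 : ∀ z : EReal, z ≤ ((z.toENNReal : ℝ≥0∞) : EReal) := fun z => by
        rcases le_total 0 z with hz | hz
        · rw [EReal.coe_toENNReal hz]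
        · exact hz.trans (EReal.coe_ennreal_nonneg _)
      refine (h2 _).trans (h'.trans ?_)
      rw [EReal.coe_ennreal_ofReal, max_eq_left hu]
    · intro h
      have := EReal.toENNReal_le_toENNReal h
      simpa using this
  rw [h1, iSup_le_iff]
  refine forall_congr' fun x => ?_
  by_cases hx : φ (x + 1) = ⊤
  · simp [hx]
  · have : ((φ (x + 1) : ℝ≥0∞) : EReal) = (((φ (x + 1)).toReal : ℝ) : EReal) := by
      exact (EReal.coe_ennreal_toReal hx).symm
    rw [this, ← EReal.coe_sub, EReal.coe_le_coe_iff]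
    simp only [ne_eq, hx, not_false_eq_true, forall_const]
    exact sub_le_iff_le_add

lemma psiStar_quasi (φ : ℝ → ℝ≥0∞) (a b y : ℝ) (h1 : a ≤ y) (h2 : y ≤ b) :
    psiStar φ y ≤ max (psiStar φ b) (psiStar φ a) := by
  by_cases hm : max (psiStar φ b) (psiStar φ a) = ⊤
  · rw [hm]; exact le_top
  obtain ⟨u, hu⟩ : ∃ u, u = (max (psiStar φ b) (psiStar φ a)).toReal := ⟨_, rfl⟩
  have hu0 : 0 ≤ u := hu ▸ ENNReal.toReal_nonneg
  have he : max (psiStar φ b) (psiStar φ a) = ENNReal.ofReal u := by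
    rw [hu, ENNReal.ofReal_toReal hm]
  have hb := (psiStar_le_ofReal φ b u hu0).1 (he ▸ le_max_left _ _)
  have ha := (psiStar_le_ofReal φ a u hu0).1 (he ▸ le_max_right _ _)
  rw [he, psiStar_le_ofReal φ y u hu0]
  intro x hx
  rcases le_total 0 x with h | h
  · have := hb x hx
    nlinarith [mul_le_mul_of_nonneg_left h2 h]
  · have := ha x hx
    nlinarith [mul_le_mul_of_nonpos_left h1 h]

/-- Minimax: a convex weight that almost attains the value. -/
lemma exists_weight (φ : ℝ → ℝ≥0∞) (t c : ℝ)
    (hc : ∀ l : ℝ, ENNReal.ofReal c ≤ max (psiStar φ (l + t)) (psiStar φ (l - t))) :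
    ∃ p : ℝ, 0 ≤ p ∧ p ≤ 1 ∧ ∀ l u v : ℝ, 0 ≤ u → 0 ≤ v →
      psiStar φ (l + t) ≤ ENNReal.ofReal u → psiStar φ (l - t) ≤ ENNReal.ofReal v →
      c ≤ p * u + (1 - p) * v := by
  let S : Set (ℝ × ℝ) := {q | 0 ≤ q.1 ∧ 0 ≤ q.2 ∧ ∃ l : ℝ,
    psiStar φ (l + t) ≤ ENNReal.ofReal q.1 ∧ psiStar φ (l - t) ≤ ENNReal.ofReal q.2}
  have hS : Convex ℝ S := by
    rintro ⟨u, v⟩ ⟨hu, hv, l, h1, h2⟩ ⟨u', v'⟩ ⟨hu', hv', l', h1', h2'⟩ a b ha hb hab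
    dsimp only at *
    have e1 : 0 ≤ a * u + b * u' := by positivity
    have e2 : 0 ≤ a * v + b * v' := by positivity
    refine ⟨e1, e2, a * l + b * l', ?_, ?_⟩
    · refine (psiStar_le_ofReal φ _ _ e1).2 fun x hx => ?_
      have k := (psiStar_le_ofReal φ _ _ hu).1 h1 x hx
      have k' := (psiStar_le_ofReal φ _ _ hu').1 h1' x hx
      have := mul_le_mul_of_nonneg_left k ha
      have := mul_le_mul_of_nonneg_left k' hb
      obtain rfl : b = 1 - a := by linarith
      nlinarith
    · refine (psiStar_le_ofReal φ _ _ e2).2 fun x hx => ?_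
      have k := (psiStar_le_ofReal φ _ _ hv).1 h2 x hx
      have k' := (psiStar_le_ofReal φ _ _ hv').1 h2' x hx
      have := mul_le_mul_of_nonneg_left k ha
      have := mul_le_mul_of_nonneg_left k' hb
      obtain rfl : b = 1 - a := by linarith
      nlinarith
  have hT : Convex ℝ (Iio c ×ˢ Iio c) := (convex_Iio c).prod (convex_Iio c)
  have hTo : IsOpen (Iio c ×ˢ Iio c) := isOpen_Iio.prod isOpen_Iio
  have hd : Disjoint (Iio c ×ˢ Iio c) S := by
    rw [Set.disjoint_left]
    rintro ⟨u, v⟩ ⟨h1, h2⟩ ⟨hu, hv, l, k1, k2⟩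
    simp only [mem_Iio] at h1 h2 hu hv k1 k2
    have := (hc l).trans (max_le_max k1 k2)
    have hcp : 0 < c := by linarith
    rcases le_max_iff.1 this with h | h
    · rw [ENNReal.ofReal_le_ofReal_iff hu] at h; linarith
    · rw [ENNReal.ofReal_le_ofReal_iff hv] at h; linarith
  obtain ⟨f, r, hf1, hf2⟩ := geometric_hahn_banach_open hT hTo hS hd
  obtain ⟨α, hα⟩ : ∃ α, α = f (1, 0) := ⟨_, rfl⟩
  obtain ⟨β, hβ⟩ : ∃ β, β = f (0, 1) := ⟨_, rfl⟩
  have hf : ∀ u v : ℝ, f (u, v) = α * u + β * v := by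
    intro u v
    have : (u, v) = u • ((1 : ℝ), (0 : ℝ)) + v • ((0 : ℝ), (1 : ℝ)) := by simp
    rw [this, map_add, map_smul, map_smul, hα, hβ]
    simp [mul_comm]
  by_cases hSe : S.Nonempty
  swap
  · refine ⟨0, le_rfl, zero_le_one, fun l u v hu hv h1 h2 => ?_⟩
    exact (hSe ⟨(u, v), hu, hv, l, h1, h2⟩).elim
  have hlt : ∀ u v : ℝ, u < c → v < c → α * u + β * v < r := fun u v h1 h2 => by
    rw [← hf]; exact hf1 _ ⟨h1, h2⟩
  have hα0 : 0 ≤ α := by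
    by_contra! h
    have hk : 0 ≤ (|r| + |β * (c - 1)|) / (-α) := by
      apply div_nonneg (by positivity); linarith
    have k1 := hlt (min (c - 1) 0 - (|r| + |β * (c - 1)|) / (-α)) (c - 1)
      (by have := min_le_left (c - 1) 0; linarith) (by linarith)
    have k2 : α * ((|r| + |β * (c - 1)|) / (-α)) = -(|r| + |β * (c - 1)|) := by
      have := h.ne
      rw [div_neg, mul_neg]; congr 1; field_simp
    have k3 : 0 ≤ α * min (c - 1) 0 := mul_nonneg_of_nonpos_of_nonpos h.le (min_le_right _ _)
    rw [mul_sub α, k2] at k1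
    have := le_abs_self r
    have := neg_abs_le (β * (c - 1))
    linarith
  have hβ0 : 0 ≤ β := by
    by_contra! h
    have hk : 0 ≤ (|r| + |α * (c - 1)|) / (-β) := by
      apply div_nonneg (by positivity); linarith
    have k1 := hlt (c - 1) (min (c - 1) 0 - (|r| + |α * (c - 1)|) / (-β)) (by linarith)
      (by have := min_le_left (c - 1) 0; linarith)
    have k2 : β * ((|r| + |α * (c - 1)|) / (-β)) = -(|r| + |α * (c - 1)|) := by
      have := h.ne
      rw [div_neg, mul_neg]; congr 1; field_simp
    have k3 : 0 ≤ β * min (c - 1) 0 := mul_nonneg_of_nonpos_of_nonpos h.le (min_le_right _ _)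
    rw [mul_sub β, k2] at k1
    have := le_abs_self r
    have := neg_abs_le (α * (c - 1))
    linarith
  have hpos : 0 < α + β := by
    rcases (add_nonneg hα0 hβ0).lt_or_eq with h | h
    · exact h
    exfalso
    have ea : α = 0 := by linarith
    have eb : β = 0 := by linarith
    obtain ⟨⟨u, v⟩, hq⟩ := hSe
    have k1 := hf2 _ hq
    have k2 := hlt (c - 1) (c - 1) (by linarith) (by linarith)
    rw [hf] at k1
    simp only [ea, eb] at k1 k2
    linarith
  have hr : (α + β) * c ≤ r := by
    refine le_of_forall_pos_le_add fun ε hε => ?_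
    have := hlt (c - ε / (α + β)) (c - ε / (α + β)) (by linarith [div_pos hε hpos])
      (by linarith [div_pos hε hpos])
    have e : (α + β) * (ε / (α + β)) = ε := by field_simp
    nlinarith
  refine ⟨α / (α + β), by positivity, (div_le_one hpos).2 (by linarith), ?_⟩
  intro l u v hu hv h1 h2
  have k := hf2 (u, v) ⟨hu, hv, l, h1, h2⟩
  rw [hf] at k
  have e : α / (α + β) * u + (1 - α / (α + β)) * v = (α * u + β * v) / (α + β) := by
    field_simp; ring
  rw [e, le_div_iff₀ hpos]
  linarith

lemma cgf_le (φ : ℝ → ℝ≥0∞) {Ω : Type*} [MeasurableSpace Ω] (ν : Measure Ω)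
    [IsProbabilityMeasure ν] (g : Ω → ℝ) (hg : ∀ ω, |g ω| ≤ 1) (t : ℝ) (ht : 0 ≤ t) :
    cgf φ ν g t ≤ ⨅ lam : ℝ, max (psiStar φ (lam + t)) (psiStar φ (lam - t)) := by
  refine iInf_mono fun l => ?_
  calc ∫⁻ ω, psiStar φ (t * g ω + l) ∂ν
      ≤ ∫⁻ _, max (psiStar φ (l + t)) (psiStar φ (l - t)) ∂ν := by
        refine lintegral_mono fun ω => ?_
        have := abs_le.1 (hg ω)
        exact psiStar_quasi φ _ _ _ (by nlinarith) (by nlinarith)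
    _ = _ := by simp

/-- **The worst-case cumulant generating function over bounded-by-one functions.**
Suppose the measurable space is nontrivial.  Then for every `t ≥ 0`,
`sup { Λ_{g,ν}(t) : ν probability measure, g measurable with |g| ≤ 1 }
  = inf_{λ ∈ ℝ} max(ψ*(λ + t), ψ*(λ − t))`. -/
theorem sup_cgf_bounded_eq_minmax {Ω : Type*} [MeasurableSpace Ω]
    (hΩ : ∃ A : Set Ω, MeasurableSet A ∧ A ≠ ∅ ∧ A ≠ Set.univ)
    (φ : ℝ → ℝ≥0∞)
    (hconv : ∀ x y : ℝ, ∀ a b : ℝ≥0, a + b = 1 →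
      φ ((a : ℝ) * x + (b : ℝ) * y) ≤ (a : ℝ≥0∞) * φ x + (b : ℝ≥0∞) * φ y)
    (hlsc : LowerSemicontinuous φ)
    (hneg : ∀ x : ℝ, x < 0 → φ x = ⊤)
    (hone : φ 1 = 0)
    (hdom : (1 : ℝ) ∈ interior {x : ℝ | φ x ≠ ⊤}) :
    ∀ t : ℝ, 0 ≤ t →
      (⨆ (ν : Measure Ω) (_ : IsProbabilityMeasure ν) (g : Ω → ℝ)
          (_ : Measurable g ∧ ∀ ω, |g ω| ≤ 1), cgf φ ν g t)
        = ⨅ lam : ℝ, max (psiStar φ (lam + t)) (psiStar φ (lam - t)) := by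
  intro t ht
  apply le_antisymm
  · refine iSup_le fun ν => iSup_le fun hν => iSup_le fun g => iSup_le fun hg => ?_
    exact cgf_le φ ν g hg.2 t ht
  · refine ENNReal.le_of_forall_nnreal_lt fun c hcM => ?_
    have hc : ∀ l : ℝ, ENNReal.ofReal c ≤ max (psiStar φ (l + t)) (psiStar φ (l - t)) := by
      intro l
      rw [ENNReal.ofReal_coe_nnreal]
      exact hcM.le.trans (iInf_le _ l)
    obtain ⟨p, hp0, hp1, hp⟩ := exists_weight φ t c hc
    obtain ⟨A, hA, hAe, hAu⟩ := hΩ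
    obtain ⟨a, ha⟩ := Set.nonempty_iff_ne_empty.2 hAe
    obtain ⟨b, hb⟩ := (Set.ne_univ_iff_exists_notMem A).1 hAu
    classical
    refine ENNReal.le_of_forall_nnreal_lt fun d hdc => ?_
    have hdc' : (d : ℝ) < c := by exact_mod_cast hdc
    have hcpos : (0 : ℝ) < c := lt_of_le_of_lt d.2 hdc'
    obtain ⟨ε, hε⟩ : ∃ ε : ℝ, ε = 1 - d / c := ⟨_, rfl⟩
    have hε0 : 0 < ε := by
      have : (d : ℝ) / c < 1 := (div_lt_one hcpos).2 hdc'
      linarith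
    have hε1 : ε ≤ 1 := by
      have : 0 ≤ (d : ℝ) / c := by positivity
      linarith
    have hεc : (1 - ε) * c = d := by rw [hε]; field_simp; ring
    obtain ⟨q, hq⟩ : ∃ q : ℝ, q = (1 - ε) * p + ε / 2 := ⟨_, rfl⟩
    have hq0 : 0 < q := by
      have : 0 ≤ (1 - ε) * p := mul_nonneg (by linarith) hp0
      linarith
    have hq1 : 0 < 1 - q := by
      have : (1 - ε) * p ≤ (1 - ε) * 1 := mul_le_mul_of_nonneg_left hp1 (by linarith)
      linarith
    let ν : Measure Ω := ENNReal.ofReal q • Measure.dirac a + ENNReal.ofReal (1 - q) • Measure.dirac b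
    have hν : IsProbabilityMeasure ν := ⟨by
      simp only [ν, Measure.coe_add, Measure.coe_smul, Pi.add_apply, Pi.smul_apply, measure_univ,
        smul_eq_mul, mul_one]
      rw [← ENNReal.ofReal_add hq0.le hq1.le]
      simp⟩
    let g : Ω → ℝ := fun ω => if ω ∈ A then 1 else -1
    have hg : Measurable g ∧ ∀ ω, |g ω| ≤ 1 := by
      refine ⟨Measurable.ite hA measurable_const measurable_const, fun ω => ?_⟩
      by_cases h : ω ∈ A <;> simp [g, h]
    refine le_trans ?_ (le_iSup_of_le ν (le_iSup_of_le hν (le_iSup_of_le g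
      (le_iSup_of_le hg le_rfl))))
    refine le_iInf fun l => ?_
    have hmeas : Measurable fun ω => psiStar φ (t * g ω + l) := by
      have : (fun ω => psiStar φ (t * g ω + l)) =
          fun ω => if ω ∈ A then psiStar φ (l + t) else psiStar φ (l - t) := by
        funext ω
        by_cases h : ω ∈ A
        · simp [g, h, add_comm]
        · simp only [g, h, if_false]; congr 1; ring
      rw [this]
      exact Measurable.ite hA measurable_const measurable_const
    have hint : ∫⁻ ω, psiStar φ (t * g ω + l) ∂ν =
        ENNReal.ofReal q * psiStar φ (l + t) + ENNReal.ofReal (1 - q) * psiStar φ (l - t) := by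
      simp only [ν]
      rw [lintegral_add_measure, lintegral_smul_measure, lintegral_smul_measure,
        lintegral_dirac' _ hmeas, lintegral_dirac' _ hmeas]
      have e1 : t * g a + l = l + t := by simp [g, ha, add_comm]
      have e2 : t * g b + l = l - t := by simp only [g, hb, if_false]; ring
      rw [e1, e2, smul_eq_mul, smul_eq_mul]
    rw [hint]
    have hq0' : ENNReal.ofReal q ≠ 0 := by simpa using hq0
    have hq1' : ENNReal.ofReal (1 - q) ≠ 0 := by
      rw [ne_eq, ENNReal.ofReal_eq_zero]; linarith
    by_cases h1 : psiStar φ (l + t) = ⊤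
    · rw [h1, ENNReal.mul_top hq0']; simp
    by_cases h2 : psiStar φ (l - t) = ⊤
    · rw [h2, ENNReal.mul_top hq1']; simp
    obtain ⟨u, hu⟩ : ∃ u, u = (psiStar φ (l + t)).toReal := ⟨_, rfl⟩
    obtain ⟨v, hv⟩ : ∃ v, v = (psiStar φ (l - t)).toReal := ⟨_, rfl⟩
    have hu0 : 0 ≤ u := hu ▸ ENNReal.toReal_nonneg
    have hv0 : 0 ≤ v := hv ▸ ENNReal.toReal_nonneg
    have eu : psiStar φ (l + t) = ENNReal.ofReal u := by rw [hu, ENNReal.ofReal_toReal h1]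
    have ev : psiStar φ (l - t) = ENNReal.ofReal v := by rw [hv, ENNReal.ofReal_toReal h2]
    have key := hp l u v hu0 hv0 eu.le ev.le
    rw [eu, ev, ← ENNReal.ofReal_mul hq0.le, ← ENNReal.ofReal_mul hq1.le,
      ← ENNReal.ofReal_add (by positivity) (by positivity), ← ENNReal.ofReal_coe_nnreal]
    apply ENNReal.ofReal_le_ofReal
    rw [← hεc]
    have k := mul_le_mul_of_nonneg_left key (sub_nonneg.2 hε1)
    have : q * u + (1 - q) * v = (1 - ε) * (p * u + (1 - p) * v) + ε / 2 * (u + v) := by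
      rw [hq]; ring
    have : 0 ≤ ε / 2 * (u + v) := by positivity
    linarith
end
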